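/- Let p, q, r be distinct primes, n a positive integer, N = p^n·q·r, and let (A,B) be a spectral pair in Z_N satisfying the standing assumptions. Then (1) the residue of p^n·r lies in Z_A or in Z_B, and (2) the residue of p^n·q lies in Z_A or in Z_B. Consequently, with I_2 = Z_A ∩ {p^n·q, p^n·r} and J_2 = Z_B ∩ {p^n·q, p^n·r}, one has |I_2| + |J_2| ≥ 2. -/

import Mathlib

open Finset

/-- `chi N A b = ∑_{a ∈ A} e^{2πi·ab/N}`. -/
noncomputable def chi (N : ℕ) (A : Finset (ZMod N)) (b : ZMod N) : ℂ :=
  ∑ a ∈ A, Complex.exp (2 * Real.pi * Complex.I * ((a * b).val : ℕ) / N)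

/-- `(A, B)` is a spectral pair in `Z_N`. -/
def IsSpectralPair (N : ℕ) (A B : Finset (ZMod N)) : Prop :=
  A.card = B.card ∧ ∀ b ∈ B, ∀ b' ∈ B, b ≠ b' → chi N A (b - b') = 0

/-- `A` tiles `Z_N` by translation. -/
def Tiles (N : ℕ) (A : Finset (ZMod N)) : Prop :=
  ∃ T : Finset (ZMod N), ∀ g : ZMod N,
    ∃! x : ZMod N × ZMod N, x.1 ∈ A ∧ x.2 ∈ T ∧ x.1 + x.2 = g

/-- `A` is a union of cosets of the subgroup `{x : m·x = 0}` of `Z_N`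
(for `m` a prime divisor of `N` this is the unique subgroup of order `m`). -/
def IsUnionOfCosets (N : ℕ) (m : ℕ) (A : Finset (ZMod N)) : Prop :=
  ∀ a ∈ A, ∀ x : ZMod N, (m : ZMod N) * x = 0 → a + x ∈ A

/-- A nonzero two-row discrepancy in an additive grid fills whole lines. -/
lemma grid_core {Q K : Type*} [Fintype Q] [Fintype K] [DecidableEq Q] (u v : Q → K → ℤ) (c : ℤ)
    (hu : ∀ j k, u j k = 0 ∨ u j k = c) (hv : ∀ j k, v j k = 0 ∨ v j k = c) (hc : 0 < c)
    (hu1 : ∀ j l k, u j k ≠ 0 → u l k ≠ 0 → j = l)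
    (hmix : ∀ j l k k', u j k - u l k - v j k + v l k = u j k' - u l k' - v j k' + v l k')
    (hsum : ∑ j, ∑ k, u j k = ∑ j, ∑ k, v j k)
    (hQ : 2 ≤ Fintype.card Q)
    (hcop : IsCoprime (Fintype.card Q : ℤ) (Fintype.card K * c))
    (j : Q) (k : K) (h1 : u j k = c) (h2 : v j k = 0) :
    (∀ k', u j k' = c) ∧ ∃ l, l ≠ j ∧ ∀ k', v l k' = c := by
  have hrow : ∀ l, ∑ k', u j k' - ∑ k', u l k' - ∑ k', v j k' + ∑ k', v l k'
      = Fintype.card K * (u j k - u l k - v j k + v l k) := by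
    intro l
    rw [← Finset.sum_sub_distrib, ← Finset.sum_sub_distrib, ← Finset.sum_add_distrib,
      Finset.sum_congr rfl (fun k' _ => hmix j l k' k)]
    simp
  have htot := Finset.sum_congr rfl (fun l (_ : l ∈ (univ : Finset Q)) => hrow l)
  rw [← Finset.mul_sum] at htot
  simp only [Finset.sum_sub_distrib, Finset.sum_add_distrib, Finset.sum_const, Finset.card_univ,
    nsmul_eq_mul] at htot
  have husum : ∑ l, u l k = c := by
    rw [Finset.sum_eq_single j, h1]
    · intro l _ hl
      by_contra h
      exact hl (hu1 l j k h (by rw [h1]; exact hc.ne'))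
    · simp
  have hex : ∃ l, v l k ≠ 0 := by
    by_contra! h
    simp only [h1, h, husum] at htot
    have hd : (Fintype.card Q : ℤ) ∣ Fintype.card K * c := by
      refine ⟨Fintype.card K * c - (∑ k', u j k' - ∑ k', v j k'), ?_⟩
      simp at htot
      linarith
    have := hcop.isUnit_of_dvd' dvd_rfl hd
    rw [Int.isUnit_iff] at this
    omega
  obtain ⟨l, hl⟩ := hex
  have hlj : l ≠ j := by rintro rfl; exact hl h2
  have hvl : v l k = c := (hv l k).resolve_left hl
  have hul : u l k = 0 := by
    by_contra h
    exact hlj (hu1 l j k h (by rw [h1]; exact hc.ne'))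
  have hpt : ∀ k', u j k' = c ∧ v l k' = c := by
    intro k'
    have := hmix j l k k'
    rw [h1, h2, hvl, hul] at this
    have a1 := hu j k'
    have a2 := hv l k'
    have a3 := hu l k'
    have a4 := hv j k'
    constructor <;> omega
  exact ⟨fun k' => (hpt k').1, l, hlj, fun k' => (hpt k').2⟩

/-- Two adjacent point-like rows agree or are both constant along the lines. -/
lemma grid_dichotomy {Q K : Type*} [Fintype Q] [Fintype K] [DecidableEq Q] (u v : Q → K → ℤ) (c : ℤ)
    (hu : ∀ j k, u j k = 0 ∨ u j k = c) (hv : ∀ j k, v j k = 0 ∨ v j k = c) (hc : 0 < c)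
    (hu1 : ∀ j l k, u j k ≠ 0 → u l k ≠ 0 → j = l) (hv1 : ∀ j l k, v j k ≠ 0 → v l k ≠ 0 → j = l)
    (hmix : ∀ j l k k', u j k - u l k - v j k + v l k = u j k' - u l k' - v j k' + v l k')
    (hsum : ∑ j, ∑ k, u j k = ∑ j, ∑ k, v j k)
    (hQ : 2 ≤ Fintype.card Q)
    (hcop : IsCoprime (Fintype.card Q : ℤ) (Fintype.card K * c)) :
    u = v ∨ ((∀ j k k', u j k = u j k') ∧ ∀ j k k', v j k = v j k') := by
  have fill : ∀ (w : Q → K → ℤ), (∀ j l k, w j k ≠ 0 → w l k ≠ 0 → j = l) → ∀ l,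
      (∀ k, w l k = c) → ∀ j k k', w j k = w j k' := by
    intro w hw1 l hl j k k'
    by_cases h : j = l
    · rw [h, hl, hl]
    · have : ∀ k, w j k = 0 := by
        intro k
        by_contra h0
        exact h (hw1 j l k h0 (by rw [hl]; exact hc.ne'))
      rw [this, this]
  by_cases h : u = v
  · exact Or.inl h
  right
  have : ∃ j k, u j k ≠ v j k := by
    by_contra! h'
    exact h (funext fun j => funext fun k => h' j k)
  obtain ⟨j, k, hjk⟩ := this
  rcases hu j k with h1 | h1
  · have h2 : v j k = c := (hv j k).resolve_left (fun h2 => hjk (by rw [h1, h2]))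
    obtain ⟨ha, l, -, hb⟩ := grid_core v u c hv hu hc hv1
      (fun j l k k' => by have := hmix j l k k'; linarith) hsum.symm hQ hcop j k h2 h1
    exact ⟨fill u hu1 l hb, fill v hv1 j ha⟩
  · have h2 : v j k = 0 := (hv j k).resolve_right (fun h2 => hjk (by rw [h1, h2]))
    obtain ⟨ha, l, -, hb⟩ := grid_core u v c hu hv hc hu1 hmix hsum hQ hcop j k h1 h2
    exact ⟨fill u hu1 j ha, fill v hv1 l hb⟩

/-- A point-like row adjacent to a row constant along lines is itself constant along lines. -/
lemma grid_const_adj {Q K : Type*} [Nontrivial Q] (u v : Q → K → ℤ) (c : ℤ)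
    (hv : ∀ j k, v j k = 0 ∨ v j k = c) (hc : 0 < c)
    (hv1 : ∀ j l k, v j k ≠ 0 → v l k ≠ 0 → j = l)
    (hmix : ∀ j l k k', u j k - u l k - v j k + v l k = u j k' - u l k' - v j k' + v l k')
    (hR : ∀ j k k', u j k = u j k') : ∀ j k k', v j k = v j k' := by
  have key : ∀ j k k', v j k = c → v j k' = c := by
    intro j k k' h
    obtain ⟨l, hl⟩ := exists_ne j
    have h0 : v l k = 0 := by
      by_contra h0
      exact hl (hv1 l j k h0 (by rw [h]; exact hc.ne'))
    have := hmix j l k k'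
    rw [hR j k k', hR l k k', h, h0] at this
    have a1 := hv j k'
    have a2 := hv l k'
    omega
  intro j k k'
  rcases hv j k with h | h
  · rcases hv j k' with h' | h'
    · rw [h, h']
    · rw [key j k' k h', h']
  · rw [h, key j k k' h]

/-- In an additive family of point-like rows, a discrepancy in the first direction produces two
points on a line in the second direction. -/
lemma grid_two_points {X Q K : Type*} [Fintype K] [Fintype Q]
    (w : X → Q → K → ℤ) (c : ℤ) (hc : 0 < c)
    (hw : ∀ x j k, w x j k = 0 ∨ w x j k = c)
    (hw1 : ∀ x j l k, w x j k ≠ 0 → w x l k ≠ 0 → j = l)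
    (hmix : ∀ x x' j l k k', w x j k - w x l k - w x' j k + w x' l k
      = w x j k' - w x l k' - w x' j k' + w x' l k')
    (hQ : 2 ≤ Fintype.card Q) (hK : 2 ≤ Fintype.card K)
    (hQK : Fintype.card Q ≠ Fintype.card K)
    (x x' : X) (j : Q) (k : K) (h1 : w x j k = c) (h2 : w x' j k = 0) :
    ∃ y l k₁ k₂, k₁ ≠ k₂ ∧ w y l k₁ = c ∧ w y l k₂ = c := by
  classical
  have alt : ∀ l, l ≠ j → ∀ k', w x j k' = c ∨ w x' l k' = c := by
    intro l hl k'
    have h0 : w x l k = 0 := by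
      by_contra h0
      exact hl (hw1 x l j k h0 (by rw [h1]; exact hc.ne'))
    have := hmix x x' j l k k'
    rw [h1, h2, h0] at this
    have a1 := hw x j k'
    have a2 := hw x' l k'
    have a3 := hw x l k'
    have a4 := hw x' j k'
    have a5 := hw x' l k
    omega
  by_cases h3 : 3 ≤ Fintype.card K
  · have : Nontrivial Q := Fintype.one_lt_card_iff_nontrivial.mp (by omega)
    obtain ⟨l, hl⟩ := exists_ne j
    obtain ⟨k₁, k₂, hne, heq⟩ := Fintype.exists_ne_map_eq_of_card_lt
      (fun k' : K => decide (w x j k' = c)) (by rw [Fintype.card_bool]; omega)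
    simp only [decide_eq_decide] at heq
    by_cases h : w x j k₁ = c
    · exact ⟨x, j, k₁, k₂, hne, h, heq.mp h⟩
    · exact ⟨x', l, k₁, k₂, hne, (alt l hl k₁).resolve_left h,
        (alt l hl k₂).resolve_left (fun h' => h (heq.mpr h'))⟩
  · have hQ3 : 3 ≤ Fintype.card Q := by omega
    obtain ⟨l, hl⟩ : ∃ l, l ∉ ({j} : Finset Q) := by
      by_contra! h
      have := Finset.card_le_card (fun a _ => h a : (univ : Finset Q) ⊆ {j})
      rw [Finset.card_univ] at this
      simp at this; omega
    obtain ⟨l', hl'⟩ : ∃ l', l' ∉ ({j, l} : Finset Q) := by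
      by_contra! h
      have := Finset.card_le_card (fun a _ => h a : (univ : Finset Q) ⊆ {j, l})
      rw [Finset.card_univ] at this
      have := Finset.card_le_two (a := j) (b := l)
      omega
    simp only [Finset.mem_singleton, Finset.mem_insert, not_or] at hl hl'
    have all : ∀ k', w x j k' = c := by
      intro k'
      by_contra h
      have b1 := (alt l hl k').resolve_left h
      have b2 := (alt l' hl'.1 k').resolve_left h
      exact hl'.2 (hw1 x' l' l k' (by rw [b2]; exact hc.ne') (by rw [b1]; exact hc.ne'))
    have : Nontrivial K := Fintype.one_lt_card_iff_nontrivial.mp (by omega)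
    obtain ⟨k₁, k₂, hne⟩ := exists_pair_ne K
    exact ⟨x, j, k₁, k₂, hne, all _, all _⟩

/-- The number of `a ∈ A` with prescribed residues modulo `p ^ i`, `q` and `r`. -/
def wt (p q r : ℕ) (A : Finset ℕ) (i x : ℕ) (j : ZMod q) (k : ZMod r) : ℤ :=
  ((A.filter fun a => a ≡ x [MOD p ^ i] ∧ (a : ZMod q) = j ∧ (a : ZMod r) = k).card : ℤ)

lemma card_filter_modEq_split {p : ℕ} (hp : 0 < p) (S : Finset ℕ) (i x : ℕ) :
    (S.filter (· ≡ x [MOD p ^ i])).card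
      = ∑ t ∈ range p, (S.filter (· ≡ x + t * p ^ i [MOD p ^ (i + 1)])).card := by
  have hpi : 0 < p ^ i := pow_pos hp i
  rw [← Finset.card_biUnion]
  · congr 1
    ext a
    simp only [mem_filter, mem_biUnion, mem_range]
    constructor
    · rintro ⟨ha, h⟩
      have hz : (x : ℤ) ≡ a [ZMOD (p ^ i : ℕ)] := (Int.natCast_modEq_iff.mpr h).symm
      obtain ⟨m, hm⟩ := hz.dvd
      refine ⟨(m % p).toNat, ?_, ha, ?_⟩
      · have := Int.emod_lt_of_pos m (by exact_mod_cast hp : (0:ℤ) < p)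
        have := Int.emod_nonneg m (by exact_mod_cast hp.ne' : (p:ℤ) ≠ 0)
        omega
      · rw [← Int.natCast_modEq_iff]
        apply Int.ModEq.symm
        rw [Int.modEq_iff_dvd]
        have h0 := Int.emod_nonneg m (by exact_mod_cast hp.ne' : (p:ℤ) ≠ 0)
        have h1 := Int.emod_add_mul_ediv m p
        refine ⟨m / p, ?_⟩
        push_cast [Int.toNat_of_nonneg h0] at hm ⊢
        rw [pow_succ]
        have : (a : ℤ) = x + p ^ i * (m % p + p * (m / p)) := by rw [h1]; linarith
        rw [this]; ring
    · rintro ⟨t, -, ha, h⟩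
      refine ⟨ha, ?_⟩
      have h' := h.of_dvd (pow_dvd_pow p (Nat.le_succ i))
      exact h'.trans (by simp [Nat.ModEq])
  · intro t ht s hs hts
    rw [Function.onFun, Finset.disjoint_filter]
    intro a _ h1 h2
    have h := Nat.ModEq.add_left_cancel' x (h1.symm.trans h2)
    rw [pow_succ'] at h
    have h3 : t ≡ s [MOD p] := Nat.ModEq.mul_right_cancel' hpi.ne' h
    simp only [coe_range, Set.mem_Iio] at ht hs
    exact hts (Nat.ModEq.eq_of_lt_of_lt h3 ht hs)

lemma wt_eq (p q r : ℕ) (A : Finset ℕ) (i x : ℕ) (j : ZMod q) (k : ZMod r) :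
    wt p q r A i x j k =
      (((A.filter fun a : ℕ => (a : ZMod q) = j ∧ (a : ZMod r) = k).filter
        (· ≡ x [MOD p ^ i])).card : ℤ) := by
  rw [wt, Finset.filter_filter]
  congr 2
  ext a
  simp only [mem_filter]
  tauto

lemma wt_split {p : ℕ} (hp : 0 < p) (q r : ℕ) (A : Finset ℕ) (i x : ℕ) (j : ZMod q) (k : ZMod r) :
    wt p q r A i x j k = ∑ t ∈ range p, wt p q r A (i + 1) (x + t * p ^ i) j k := by
  simp only [wt_eq]
  rw [card_filter_modEq_split hp]
  push_cast
  rfl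

lemma wt_congr {p q r : ℕ} {A : Finset ℕ} {i x y : ℕ} (h : x ≡ y [MOD p ^ i]) (j : ZMod q)
    (k : ZMod r) : wt p q r A i x j k = wt p q r A i y j k := by
  rw [wt, wt]
  congr 2
  ext a
  simp only [mem_filter]
  exact ⟨fun h' => ⟨h'.1, h'.2.1.trans h, h'.2.2⟩, fun h' => ⟨h'.1, h'.2.1.trans h.symm, h'.2.2⟩⟩

lemma sum_wt_right (p q r : ℕ) [NeZero r] (A : Finset ℕ) (i x : ℕ) (j : ZMod q) :
    ∑ k, wt p q r A i x j k
      = ((A.filter fun a => a ≡ x [MOD p ^ i] ∧ (a : ZMod q) = j).card : ℤ) := by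
  rw [Finset.card_eq_sum_card_fiberwise (f := fun a : ℕ => (a : ZMod r)) (t := univ) (by simp)]
  push_cast
  refine Finset.sum_congr rfl fun k _ => ?_
  rw [wt, Finset.filter_filter]
  simp only [and_assoc]

lemma sum_wt_left (p q r : ℕ) [NeZero q] (A : Finset ℕ) (i x : ℕ) (k : ZMod r) :
    ∑ j, wt p q r A i x j k
      = ((A.filter fun a => a ≡ x [MOD p ^ i] ∧ (a : ZMod r) = k).card : ℤ) := by
  rw [Finset.card_eq_sum_card_fiberwise (f := fun a : ℕ => (a : ZMod q)) (t := univ) (by simp)]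
  push_cast
  refine Finset.sum_congr rfl fun k _ => ?_
  rw [wt, Finset.filter_filter]
  congr 2
  ext a
  simp only [mem_filter]
  tauto

lemma sum_sum_wt (p q r : ℕ) [NeZero q] [NeZero r] (A : Finset ℕ) (i x : ℕ) :
    ∑ j, ∑ k, wt p q r A i x j k = ((A.filter (· ≡ x [MOD p ^ i])).card : ℤ) := by
  rw [Finset.card_eq_sum_card_fiberwise (f := fun a : ℕ => (a : ZMod q)) (t := univ) (by simp)]
  push_cast
  refine Finset.sum_congr rfl fun k _ => ?_
  rw [sum_wt_right, Finset.filter_filter]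

lemma wt_nonneg (p q r : ℕ) (A : Finset ℕ) (i x : ℕ) (j : ZMod q) (k : ZMod r) :
    0 ≤ wt p q r A i x j k := by
  rw [wt]; positivity

lemma wt_ne_zero_iff {p q r : ℕ} {A : Finset ℕ} {i x : ℕ} {j : ZMod q} {k : ZMod r} :
    wt p q r A i x j k ≠ 0 ↔
      ∃ a ∈ A, a ≡ x [MOD p ^ i] ∧ (a : ZMod q) = j ∧ (a : ZMod r) = k := by
  rw [wt, Nat.cast_ne_zero, ← Nat.pos_iff_ne_zero, Finset.card_pos]
  simp [Finset.Nonempty]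

/-- Vanishing of the characters of order `p ^ (i + 1)`, in terms of counts. -/
def VanP (p q r : ℕ) [NeZero q] [NeZero r] (A : Finset ℕ) (i : ℕ) : Prop :=
  ∀ x x', x ≡ x' [MOD p ^ i] →
    ∑ j, ∑ k, wt p q r A (i + 1) x j k = ∑ j, ∑ k, wt p q r A (i + 1) x' j k

/-- Vanishing of the characters of order `p ^ (i + 1) * q`, in terms of counts. -/
def VanPQ (p q r : ℕ) [NeZero r] (A : Finset ℕ) (i : ℕ) : Prop :=
  ∀ x x', x ≡ x' [MOD p ^ i] → ∀ j l,
    ∑ k, wt p q r A (i + 1) x j k - ∑ k, wt p q r A (i + 1) x l k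
      - ∑ k, wt p q r A (i + 1) x' j k + ∑ k, wt p q r A (i + 1) x' l k = 0

/-- Vanishing of the characters of order `p ^ (i + 1) * r`, in terms of counts. -/
def VanPR (p q r : ℕ) [NeZero q] (A : Finset ℕ) (i : ℕ) : Prop :=
  ∀ x x', x ≡ x' [MOD p ^ i] → ∀ k k',
    ∑ j, wt p q r A (i + 1) x j k - ∑ j, wt p q r A (i + 1) x j k'
      - ∑ j, wt p q r A (i + 1) x' j k + ∑ j, wt p q r A (i + 1) x' j k' = 0

/-- Vanishing of the characters of order `p ^ (i + 1) * q * r`, in terms of counts. -/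
def VanPQR (p q r : ℕ) (A : Finset ℕ) (i : ℕ) : Prop :=
  ∀ x x', x ≡ x' [MOD p ^ i] → ∀ j l k k',
    wt p q r A (i + 1) x j k - wt p q r A (i + 1) x l k
      - wt p q r A (i + 1) x' j k + wt p q r A (i + 1) x' l k
    = wt p q r A (i + 1) x j k' - wt p q r A (i + 1) x l k'
      - wt p q r A (i + 1) x' j k' + wt p q r A (i + 1) x' l k'

/-- Vanishing of the characters of order `r`, in terms of counts. -/
def VanR (p q r : ℕ) [NeZero q] (A : Finset ℕ) : Prop :=
  ∀ k k', ∑ j, wt p q r A 0 0 j k = ∑ j, wt p q r A 0 0 j k'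

/-- Vanishing of the characters of order `q * r`, in terms of counts. -/
def VanQR (p q r : ℕ) (A : Finset ℕ) : Prop :=
  ∀ j l k k', wt p q r A 0 0 j k - wt p q r A 0 0 l k - wt p q r A 0 0 j k'
    + wt p q r A 0 0 l k' = 0

/-- The differences of `B` are zeros of the characters of `A`, differences of order `q` do not
occur in `B`, and elements of `B` are determined by their residues. -/
structure DiffVanish (p q r n : ℕ) [NeZero q] [NeZero r] (A B : Finset ℕ) : Prop where
  vanP : ∀ b ∈ B, ∀ b' ∈ B, ∀ e i, e + i + 1 = n → b ≡ b' [MOD p ^ e] → ¬ b ≡ b' [MOD p ^ (e + 1)] →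
    (b : ZMod q) = b' → (b : ZMod r) = b' → VanP p q r A i
  vanPQ : ∀ b ∈ B, ∀ b' ∈ B, ∀ e i, e + i + 1 = n → b ≡ b' [MOD p ^ e] → ¬ b ≡ b' [MOD p ^ (e + 1)] →
    (b : ZMod q) ≠ b' → (b : ZMod r) = b' → VanPQ p q r A i
  vanPR : ∀ b ∈ B, ∀ b' ∈ B, ∀ e i, e + i + 1 = n → b ≡ b' [MOD p ^ e] → ¬ b ≡ b' [MOD p ^ (e + 1)] →
    (b : ZMod q) = b' → (b : ZMod r) ≠ b' → VanPR p q r A i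
  vanPQR : ∀ b ∈ B, ∀ b' ∈ B, ∀ e i, e + i + 1 = n → b ≡ b' [MOD p ^ e] →
    ¬ b ≡ b' [MOD p ^ (e + 1)] → (b : ZMod q) ≠ b' → (b : ZMod r) ≠ b' → VanPQR p q r A i
  vanR : ∀ b ∈ B, ∀ b' ∈ B, b ≡ b' [MOD p ^ n] → (b : ZMod q) = b' → (b : ZMod r) ≠ b' →
    VanR p q r A
  vanQR : ∀ b ∈ B, ∀ b' ∈ B, b ≡ b' [MOD p ^ n] → (b : ZMod q) ≠ b' → (b : ZMod r) ≠ b' →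
    VanQR p q r A
  inj : ∀ b ∈ B, ∀ b' ∈ B, b ≡ b' [MOD p ^ n] → (b : ZMod r) = b' → b = b'

open Classical in
/-- The levels `i < n` for which characters of order `p ^ (i + 1)` vanish on `A`. -/
noncomputable def pLevels (p q r n : ℕ) [NeZero q] [NeZero r] (A : Finset ℕ) : Finset ℕ :=
  (range n).filter (VanP p q r A)

lemma mem_pLevels {p q r n : ℕ} [NeZero q] [NeZero r] {A : Finset ℕ} {i : ℕ} :
    i ∈ pLevels p q r n A ↔ i < n ∧ VanP p q r A i := by
  simp [pLevels]

lemma card_filter_lt_succ (I : Finset ℕ) (m : ℕ) :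
    (I.filter (· < m + 1)).card = (I.filter (· < m)).card + if m ∈ I then 1 else 0 := by
  split_ifs with h
  · have : I.filter (· < m + 1) = insert m (I.filter (· < m)) := by
      ext a; simp only [mem_filter, mem_insert]
      constructor
      · rintro ⟨h1, h2⟩
        by_cases h3 : a = m
        · exact Or.inl h3
        · exact Or.inr ⟨h1, by omega⟩
      · rintro (rfl | ⟨h1, h2⟩)
        · exact ⟨h, by omega⟩
        · exact ⟨h1, by omega⟩
    rw [this, Finset.card_insert_of_notMem (by simp)]
  · have : I.filter (· < m + 1) = I.filter (· < m) := by
      ext a; simp only [mem_filter]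
      constructor
      · rintro ⟨h1, h2⟩
        refine ⟨h1, ?_⟩
        by_contra h3
        obtain rfl : a = m := by omega
        exact h h1
      · rintro ⟨h1, h2⟩
        exact ⟨h1, by omega⟩
    rw [this, add_zero]

lemma card_filter_ge (I : Finset ℕ) (m : ℕ) :
    (I.filter (m ≤ ·)).card = (I.filter (m + 1 ≤ ·)).card + if m ∈ I then 1 else 0 := by
  have h1 := Finset.card_filter_add_card_filter_not (s := I) (· < m)
  have h2 := Finset.card_filter_add_card_filter_not (s := I) (· < m + 1)
  simp only [not_lt] at h1 h2
  have := card_filter_lt_succ I m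
  omega

section Levels

variable {p q r n : ℕ} [NeZero q] [NeZero r] {A B : Finset ℕ}

lemma pow_dvd_card_filter (hp : 0 < p) (m : ℕ) (hm : m ≤ n) (x : ℕ) :
    p ^ ((pLevels p q r n A).filter (n - m ≤ ·)).card ∣ (A.filter (· ≡ x [MOD p ^ (n - m)])).card := by
  induction m generalizing x with
  | zero =>
    have : (pLevels p q r n A).filter (n - 0 ≤ ·) = ∅ := by
      ext i; simp only [mem_filter, mem_pLevels, notMem_empty, iff_false]; omega
    rw [this]; simp
  | succ m ih =>
    have hm' : n - m = n - (m + 1) + 1 := by omega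
    have ih' := fun x => ih (by omega) x
    rw [card_filter_ge, card_filter_modEq_split hp]
    rw [hm'] at ih'
    split_ifs with h
    · have hv := (mem_pLevels.mp h).2
      have : ∀ t ∈ range p, (A.filter (· ≡ x + t * p ^ (n - (m + 1)) [MOD p ^ (n - (m + 1) + 1)])).card
          = (A.filter (· ≡ x [MOD p ^ (n - (m + 1) + 1)])).card := by
        intro t _
        have := hv (x + t * p ^ (n - (m + 1))) x (by simp [Nat.ModEq])
        rw [sum_sum_wt, sum_sum_wt] at this
        exact_mod_cast this
      rw [Finset.sum_congr rfl this, Finset.sum_const, card_range, smul_eq_mul, pow_succ']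
      exact mul_dvd_mul_left p (ih' x)
    · exact Finset.dvd_sum fun t _ => ih' _

lemma pow_card_pLevels_dvd (hp : 0 < p) : p ^ (pLevels p q r n A).card ∣ A.card := by
  have := pow_dvd_card_filter (p := p) (q := q) (r := r) (n := n) (A := A) hp n le_rfl 0
  simpa [Nat.modEq_one] using this

/-- Elements of `B` with common residues modulo `q`, `r` and `p ^ (n - m)` are few. -/
lemma DiffVanish.card_le (h : DiffVanish p q r n A B) (hp : 0 < p) (m : ℕ) (hm : m ≤ n)
    (X : Finset ℕ) (hX : X ⊆ B) (hq : ∀ x ∈ X, ∀ y ∈ X, (x : ZMod q) = y)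
    (hr : ∀ x ∈ X, ∀ y ∈ X, (x : ZMod r) = y) (hc : ∀ x ∈ X, ∀ y ∈ X, x ≡ y [MOD p ^ (n - m)]) :
    X.card ≤ p ^ ((pLevels p q r n A).filter (· < m)).card := by
  induction m generalizing X with
  | zero =>
    simp only [not_lt_zero, filter_false, card_empty, pow_zero]
    refine Finset.card_le_one.mpr fun x hx y hy => ?_
    exact h.inj x (hX hx) y (hX hy) (by simpa using hc x hx y hy) (hr x hx y hy)
  | succ m ih =>
    have hm' : n - m = n - (m + 1) + 1 := by omega
    rw [card_filter_lt_succ]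
    split_ifs with hI
    · rcases X.eq_empty_or_nonempty with rfl | ⟨x₀, hx₀⟩
      · simp
      have hall : X.filter (· ≡ x₀ [MOD p ^ (n - (m + 1))]) = X :=
        Finset.filter_true_of_mem fun x hx => hc x hx x₀ hx₀
      rw [← hall, card_filter_modEq_split hp, pow_succ' p (card _)]
      refine (Finset.sum_le_card_nsmul _ _ _ fun t _ => ih (by omega) _
        ((filter_subset _ _).trans hX) ?_ ?_ ?_).trans_eq (by rw [card_range, smul_eq_mul])
      · intro x hx y hy
        exact hq x (mem_filter.mp hx).1 y (mem_filter.mp hy).1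
      · intro x hx y hy
        exact hr x (mem_filter.mp hx).1 y (mem_filter.mp hy).1
      · intro x hx y hy
        rw [hm']
        exact (mem_filter.mp hx).2.trans (mem_filter.mp hy).2.symm
    · refine ih (by omega) X hX hq hr fun x hx y hy => ?_
      rw [hm']
      by_contra hne
      exact hI (mem_pLevels.mpr ⟨by omega, h.vanP x (hX hx) y (hX hy) (n - (m + 1)) m (by omega)
        (hc x hx y hy) hne (hq x hx y hy) (hr x hx y hy)⟩)

/-- Extremal sets in `DiffVanish.card_le` split evenly. -/
lemma DiffVanish.card_filter_eq (h : DiffVanish p q r n A B) (hp : 0 < p) (m : ℕ) (hm : m + 1 ≤ n)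
    (X : Finset ℕ) (hX : X ⊆ B) (hq : ∀ x ∈ X, ∀ y ∈ X, (x : ZMod q) = y)
    (hr : ∀ x ∈ X, ∀ y ∈ X, (x : ZMod r) = y) (c : ℕ)
    (hc : ∀ x ∈ X, x ≡ c [MOD p ^ (n - (m + 1))])
    (hcard : X.card = p ^ ((pLevels p q r n A).filter (· < m + 1)).card)
    (hI : m ∈ pLevels p q r n A) (t : ℕ) (ht : t < p) :
    (X.filter (· ≡ c + t * p ^ (n - (m + 1)) [MOD p ^ (n - m)])).card
      = p ^ ((pLevels p q r n A).filter (· < m)).card := by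
  have hm' : n - m = n - (m + 1) + 1 := by omega
  have hall : X.filter (· ≡ c [MOD p ^ (n - (m + 1))]) = X :=
    Finset.filter_true_of_mem fun x hx => hc x hx
  have hle : ∀ t ∈ range p, (X.filter (· ≡ c + t * p ^ (n - (m + 1)) [MOD p ^ (n - m)])).card
      ≤ p ^ ((pLevels p q r n A).filter (· < m)).card := by
    intro t _
    refine h.card_le hp m (by omega) _ ((filter_subset _ _).trans hX) ?_ ?_ ?_
    · intro x hx y hy
      exact hq x (mem_filter.mp hx).1 y (mem_filter.mp hy).1
    · intro x hx y hy
      exact hr x (mem_filter.mp hx).1 y (mem_filter.mp hy).1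
    · intro x hx y hy
      exact (mem_filter.mp hx).2.trans (mem_filter.mp hy).2.symm
  have hsum := card_filter_modEq_split hp X (n - (m + 1)) c
  rw [hall, hcard, card_filter_lt_succ, if_pos hI, ← hm', pow_succ'] at hsum
  have := (Finset.sum_eq_sum_iff_of_le hle).mp (by
    rw [← hsum, Finset.sum_const, card_range, smul_eq_mul])
  exact this t (mem_range.mpr ht)

end Levels

section Agreement

variable {ι α β γ : Type*}

/-- If any two members agree under `f` or under `g`, then `f` or `g` is constant. -/
lemma const_or_const_of_agree (S : Finset ι) (f : ι → α) (g : ι → β)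
    (h : ∀ x ∈ S, ∀ y ∈ S, f x = f y ∨ g x = g y) :
    (∀ x ∈ S, ∀ y ∈ S, f x = f y) ∨ ∀ x ∈ S, ∀ y ∈ S, g x = g y := by
  by_contra! hc
  obtain ⟨⟨x, hx, y, hy, hxy⟩, z, hz, w, hw, hzw⟩ := hc
  have h1 := h x hx y hy
  have h2 := h x hx z hz
  have h3 := h x hx w hw
  have h4 := h y hy z hz
  have h5 := h y hy w hw
  grind

/-- All members agree with `(a, b, c)` in at least two coordinates. -/
def Majority (S : Finset ι) (f : ι → α) (g : ι → β) (h : ι → γ) (a : α) (b : β) (c : γ) : Prop :=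
  ∀ v ∈ S, (f v = a ∧ g v = b) ∨ (f v = a ∧ h v = c) ∨ (g v = b ∧ h v = c)

lemma majority_of_three_values_aux (S : Finset ι) (f : ι → α) (g : ι → β) (h : ι → γ)
    (hpair : ∀ x ∈ S, ∀ y ∈ S, f x = f y ∨ g x = g y ∨ h x = h y)
    (hg : ¬ ∀ x ∈ S, ∀ y ∈ S, g x = g y) (hh : ¬ ∀ x ∈ S, ∀ y ∈ S, h x = h y)
    {x y z : ι} (hx : x ∈ S) (hy : y ∈ S) (hz : z ∈ S) (hxy : f x ≠ f y) (hxz : f x ≠ f z)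
    (hyz : f y ≠ f z) (hgy : g x = g y) (hgz : g x = g z) :
    ∃ a b c, Majority S f g h a b c := by
  have key : ∀ x ∈ S, ∀ y ∈ S, ∀ z ∈ S, ∀ w ∈ S, f x ≠ f y → f x ≠ f z → f y ≠ f z → g x = g y →
      g x = g z → g w ≠ g x → h w = h x → h w = h y → h z ≠ h w →
      ∃ a b c, Majority S f g h a b c := by
    intro x hx y hy z hz w hw hxy hxz hyz hgy hgz hgw h1 h2 h3
    refine ⟨f z, g x, h x, fun v hv => ?_⟩
    have a1 := hpair z hz w hw
    have a2 := hpair v hv x hx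
    have a3 := hpair v hv y hy
    have a4 := hpair v hv z hz
    have a5 := hpair v hv w hw
    grind
  obtain ⟨w, hw, hgw⟩ : ∃ w ∈ S, g w ≠ g x := by
    by_contra! hc
    exact hg fun u hu v hv => (hc u hu).trans (hc v hv).symm
  have a1 := hpair w hw x hx
  have a2 := hpair w hw y hy
  have a3 := hpair w hw z hz
  by_cases hall : h w = h x ∧ h w = h y ∧ h w = h z
  · obtain ⟨e1, e2, e3⟩ := hall
    refine ⟨f w, g x, h x, fun v hv => ?_⟩
    obtain ⟨u, hu, hhu⟩ : ∃ u ∈ S, h u ≠ h x := by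
      by_contra! hc
      exact hh fun u hu v hv => (hc u hu).trans (hc v hv).symm
    have b1 := hpair v hv x hx
    have b2 := hpair v hv y hy
    have b3 := hpair v hv z hz
    have b4 := hpair v hv u hu
    have b5 := hpair v hv w hw
    have b6 := hpair u hu w hw
    have c1 := hpair u hu x hx
    have c2 := hpair u hu y hy
    have c3 := hpair u hu z hz
    grind
  · by_cases e1 : h w = h x
    · by_cases e2 : h w = h y
      · exact key x hx y hy z hz w hw hxy hxz hyz hgy hgz hgw e1 e2 (by grind)
      · exact key x hx z hz y hy w hw hxz hxy hyz.symm hgz hgy hgw e1 (by grind) (by grind)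
    · exact key y hy z hz x hx w hw hyz hxy.symm hxz.symm (by grind) (by grind) (by grind)
        (by grind) (by grind) (by grind)

lemma majority_of_three_values (S : Finset ι) (f : ι → α) (g : ι → β) (h : ι → γ)
    (hpair : ∀ x ∈ S, ∀ y ∈ S, f x = f y ∨ g x = g y ∨ h x = h y)
    (hg : ¬ ∀ x ∈ S, ∀ y ∈ S, g x = g y) (hh : ¬ ∀ x ∈ S, ∀ y ∈ S, h x = h y)
    {x y z : ι} (hx : x ∈ S) (hy : y ∈ S) (hz : z ∈ S) (hxy : f x ≠ f y) (hxz : f x ≠ f z)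
    (hyz : f y ≠ f z) : ∃ a b c, Majority S f g h a b c := by
  have a1 := hpair x hx y hy
  have a2 := hpair x hx z hz
  have a3 := hpair y hy z hz
  by_cases hgc : g x = g y ∧ g x = g z
  · exact majority_of_three_values_aux S f g h hpair hg hh hx hy hz hxy hxz hyz hgc.1 hgc.2
  · obtain ⟨a, c, b, hm⟩ := majority_of_three_values_aux S f h g
      (fun x hx y hy => by have := hpair x hx y hy; tauto) hh hg hx hy hz hxy hxz hyz
      (by grind) (by grind)
    exact ⟨a, b, c, fun v hv => by have := hm v hv; tauto⟩

lemma exists_not_image [Fintype α] (S : Finset ι) (f : ι → α) (hα : 3 ≤ Fintype.card α)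
    (h3 : ∀ x ∈ S, ∀ y ∈ S, ∀ z ∈ S, f x ≠ f y → f x ≠ f z → f y ≠ f z → False) :
    ∃ d, ∀ x ∈ S, f x ≠ d := by
  classical
  by_contra! hc
  obtain ⟨a, -, b, -, c, -, hab, hac, hbc⟩ := Finset.two_lt_card.mp
    (show 2 < (univ : Finset α).card by rw [Finset.card_univ]; omega)
  obtain ⟨x, hx, rfl⟩ := hc a
  obtain ⟨y, hy, rfl⟩ := hc b
  obtain ⟨z, hz, rfl⟩ := hc c
  exact h3 x hx y hy z hz hab hac hbc

/-- The joint counts of `f` and `g` on `S` have vanishing mixed differences. -/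
def MixVan [DecidableEq α] [DecidableEq β] (S : Finset ι) (f : ι → α) (g : ι → β) : Prop :=
  ∀ d d' j j', (((S.filter fun b => f b = d ∧ g b = j).card : ℤ)
    - (S.filter fun b => f b = d ∧ g b = j').card - (S.filter fun b => f b = d' ∧ g b = j).card
    + (S.filter fun b => f b = d' ∧ g b = j').card) = 0

lemma MixVan.eq_empty [DecidableEq α] [DecidableEq β] {S : Finset ι} {f : ι → α} {g : ι → β}
    (h : MixVan S f g) {d : α} {j : β} (hd : ∀ x ∈ S, f x ≠ d) (hj : ∀ x ∈ S, g x ≠ j) :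
    S = ∅ := by
  by_contra hne
  obtain ⟨x, hx⟩ := Finset.nonempty_iff_ne_empty.mpr hne
  have := h (f x) d (g x) j
  rw [Finset.filter_false_of_mem (p := fun b => f b = f x ∧ g b = j) (fun b hb hc => hj b hb hc.2),
    Finset.filter_false_of_mem (p := fun b => f b = d ∧ g b = g x) (fun b hb hc => hd b hb hc.1),
    Finset.filter_false_of_mem (p := fun b => f b = d ∧ g b = j) (fun b hb hc => hd b hb hc.1)]
    at this
  simp only [card_empty, Nat.cast_zero, sub_zero, add_zero, Nat.cast_eq_zero, card_eq_zero] at this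
  have hx' : x ∈ S.filter fun b => f b = f x ∧ g b = g x := by simp [hx]
  rw [this] at hx'
  simp at hx'

lemma MixVan.card_eq [Fintype α] [Fintype β] [DecidableEq α] [DecidableEq β] {S : Finset ι}
    {f : ι → α} {g : ι → β} (h : MixVan S f g) {d₀ d₁ : α} {j₀ j₁ : β}
    (hS : ∀ x ∈ S, f x = d₀ ∨ g x = j₀) (hd : d₁ ≠ d₀) (hj : j₁ ≠ j₀) :
    S.card = Fintype.card α * (S.filter fun b => f b = d₁).card
      + Fintype.card β * (S.filter fun b => g b = j₁).card := by
  have e1 : ∀ d, d ≠ d₀ → ((S.filter fun b => f b = d).card : ℤ)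
      + (S.filter fun b => g b = j₁).card = (S.filter fun b => f b = d₀ ∧ g b = j₀).card := by
    intro d hd
    have := h d d₀ j₀ j₁
    have c1 : (S.filter fun b => f b = d ∧ g b = j₀) = S.filter fun b => f b = d :=
      Finset.filter_congr fun b hb => by have := hS b hb; grind
    have c2 : (S.filter fun b => f b = d₀ ∧ g b = j₁) = S.filter fun b => g b = j₁ :=
      Finset.filter_congr fun b hb => by have := hS b hb; grind
    have c3 : (S.filter fun b => f b = d ∧ g b = j₁) = ∅ :=
      Finset.filter_false_of_mem fun b hb => by have := hS b hb; grind
    rw [c1, c2, c3, card_empty] at this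
    push_cast at this
    linarith
  have e2 : ∀ j, j ≠ j₀ → ((S.filter fun b => g b = j).card : ℤ)
      + (S.filter fun b => f b = d₁).card = (S.filter fun b => f b = d₀ ∧ g b = j₀).card := by
    intro j hj
    have := h d₁ d₀ j₀ j
    have c1 : (S.filter fun b => f b = d₁ ∧ g b = j₀) = S.filter fun b => f b = d₁ :=
      Finset.filter_congr fun b hb => by have := hS b hb; grind
    have c2 : (S.filter fun b => f b = d₀ ∧ g b = j) = S.filter fun b => g b = j :=
      Finset.filter_congr fun b hb => by have := hS b hb; grind
    have c3 : (S.filter fun b => f b = d₁ ∧ g b = j) = ∅ :=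
      Finset.filter_false_of_mem fun b hb => by have := hS b hb; grind
    rw [c1, c2, c3, card_empty] at this
    push_cast at this
    linarith
  have s1 : (S.card : ℤ) = ∑ d, ((S.filter fun b => f b = d).card : ℤ) := by
    rw [Finset.card_eq_sum_card_fiberwise (f := f) (t := univ) (by simp)]
    push_cast; rfl
  have s2 : ((S.filter fun b => f b = d₀).card : ℤ)
      = ∑ j, ((S.filter fun b => f b = d₀ ∧ g b = j).card : ℤ) := by
    rw [Finset.card_eq_sum_card_fiberwise (f := g) (t := univ) (by simp)]
    push_cast
    exact Finset.sum_congr rfl fun j _ => by rw [Finset.filter_filter]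
  have t1 : ∑ d ∈ univ.erase d₀, ((S.filter fun b => f b = d).card : ℤ)
      = (Fintype.card α - 1) * (S.filter fun b => f b = d₁).card := by
    rw [Finset.sum_congr rfl (g := fun _ => ((S.filter fun b => f b = d₁).card : ℤ)) fun d hd' => by
      have h1 := e1 d (Finset.ne_of_mem_erase hd'); have h2 := e1 d₁ hd; linarith]
    rw [Finset.sum_const, Finset.card_erase_of_mem (mem_univ _), Finset.card_univ, nsmul_eq_mul,
      Nat.cast_sub (Fintype.card_pos_iff.mpr ⟨d₀⟩), Nat.cast_one]
  have t2 : ∑ j ∈ univ.erase j₀, ((S.filter fun b => f b = d₀ ∧ g b = j).card : ℤ)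
      = (Fintype.card β - 1) * (S.filter fun b => g b = j₁).card := by
    rw [Finset.sum_congr rfl (g := fun _ => ((S.filter fun b => g b = j₁).card : ℤ)) fun j hj' => by
      have h1 := e2 j (Finset.ne_of_mem_erase hj'); have h2 := e2 j₁ hj
      have c2 : (S.filter fun b => f b = d₀ ∧ g b = j) = S.filter fun b => g b = j :=
        Finset.filter_congr fun b hb => by
          have := hS b hb; have := Finset.ne_of_mem_erase hj'; grind
      rw [c2]; linarith]
    rw [Finset.sum_const, Finset.card_erase_of_mem (mem_univ _), Finset.card_univ, nsmul_eq_mul,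
      Nat.cast_sub (Fintype.card_pos_iff.mpr ⟨j₀⟩), Nat.cast_one]
  rw [← Finset.add_sum_erase _ _ (mem_univ d₀)] at s1
  rw [← Finset.add_sum_erase _ _ (mem_univ j₀)] at s2
  have := e1 d₁ hd
  have : (S.card : ℤ) = Fintype.card α * (S.filter fun b => f b = d₁).card
      + Fintype.card β * (S.filter fun b => g b = j₁).card := by
    rw [s1, s2, t1, t2, ← this]; ring
  exact_mod_cast this

end Agreement

/-- A pair of sets of naturals behaving like a spectral pair in `ℤ / p ^ n q r` without differences
of order `q`, subject to the genericity assumptions. -/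
structure CubePair (p q r n : ℕ) [NeZero q] [NeZero r] (A B : Finset ℕ) : Prop where
  hp : p.Prime
  hq : q.Prime
  hr : r.Prime
  hpq : p ≠ q
  hpr : p ≠ r
  hqr : q ≠ r
  hn : 0 < n
  hAB : DiffVanish p q r n A B
  hBA : DiffVanish p q r n B A
  card_eq : A.card = B.card
  nonempty : B.Nonempty
  digit : ¬ ∀ b ∈ B, ∀ b' ∈ B, b ≡ b' [MOD p]
  resQ : ¬ ∀ b ∈ B, ∀ b' ∈ B, (b : ZMod q) = b'
  resR : ¬ ∀ b ∈ B, ∀ b' ∈ B, (b : ZMod r) = b'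
  notP : ∃ a ∈ A, ∃ x', x' ≡ a [MOD p ^ (n - 1)] ∧ wt p q r A n x' a a = 0
  notR : ∃ a ∈ A, ∃ k, wt p q r A n a a k = 0

section

variable {p q r n : ℕ} [NeZero q] [NeZero r] {A B : Finset ℕ}

lemma mixVan_of_vanPQ [NeZero p] (h : VanPQ p q r B 0) :
    MixVan B (fun b : ℕ => (b : ZMod p)) (fun b : ℕ => (b : ZMod q)) := by
  intro d d' j j'
  have := h d.val d'.val (by simp [Nat.modEq_one]) j j'
  simp only [sum_wt_right, zero_add, pow_one, ← ZMod.natCast_eq_natCast_iff, ZMod.natCast_val,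
    ZMod.cast_id', id_eq] at this
  linarith

lemma mixVan_of_vanPR [NeZero p] (h : VanPR p q r B 0) :
    MixVan B (fun b : ℕ => (b : ZMod p)) (fun b : ℕ => (b : ZMod r)) := by
  intro d d' j j'
  have := h d.val d'.val (by simp [Nat.modEq_one]) j j'
  simp only [sum_wt_left, zero_add, pow_one, ← ZMod.natCast_eq_natCast_iff, ZMod.natCast_val,
    ZMod.cast_id', id_eq] at this
  linarith

lemma mixVan_of_vanQR (h : VanQR p q r B) :
    MixVan B (fun b : ℕ => (b : ZMod q)) (fun b : ℕ => (b : ZMod r)) := by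
  intro d d' j j'
  have := h d d' j j'
  simp only [wt, pow_zero, Nat.modEq_one, true_and] at this
  linarith

lemma DiffVanish.wt_eq_zero_or_one (h : DiffVanish p q r n B A) (x : ℕ) (j : ZMod q) (k : ZMod r) :
    wt p q r A n x j k = 0 ∨ wt p q r A n x j k = 1 := by
  have : (A.filter fun a => a ≡ x [MOD p ^ n] ∧ (a : ZMod q) = j ∧ (a : ZMod r) = k).card ≤ 1 := by
    refine Finset.card_le_one.mpr fun a ha b hb => ?_
    simp only [mem_filter] at ha hb
    exact h.inj a ha.1 b hb.1 (ha.2.1.trans hb.2.1.symm) (ha.2.2.2.trans hb.2.2.2.symm)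
  rw [wt]
  omega

lemma DiffVanish.wt_unique (h : DiffVanish p q r n B A) (x : ℕ) (j l : ZMod q) (k : ZMod r)
    (h1 : wt p q r A n x j k ≠ 0) (h2 : wt p q r A n x l k ≠ 0) : j = l := by
  obtain ⟨a, ha, ha1, ha2, ha3⟩ := wt_ne_zero_iff.mp h1
  obtain ⟨b, hb, hb1, hb2, hb3⟩ := wt_ne_zero_iff.mp h2
  have := h.inj a ha b hb (ha1.trans hb1.symm) (ha3.trans hb3.symm)
  rw [← ha2, ← hb2, this]

lemma DiffVanish.sum_wt_le_one (h : DiffVanish p q r n B A) (x : ℕ) (k : ZMod r) :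
    ∑ j, wt p q r A n x j k = 0 ∨ ∑ j, wt p q r A n x j k = 1 := by
  rw [sum_wt_left]
  have : (A.filter fun a => a ≡ x [MOD p ^ n] ∧ (a : ZMod r) = k).card ≤ 1 := by
    refine Finset.card_le_one.mpr fun a ha b hb => ?_
    simp only [mem_filter] at ha hb
    exact h.inj a ha.1 b hb.1 (ha.2.1.trans hb.2.1.symm) (ha.2.2.trans hb.2.2.symm)
  omega

lemma wt_self_ne_zero {a : ℕ} (ha : a ∈ A) (i : ℕ) : wt p q r A i a a a ≠ 0 :=
  wt_ne_zero_iff.mpr ⟨a, ha, rfl, rfl, rfl⟩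

/-- Full slices at the finest level force the `r`-projection to be invariant. -/
lemma proj_invariant (hq : q.Prime) (hr : r.Prime) (hqr : q ≠ r) (hBA : DiffVanish p q r n B A)
    (hn : 0 < n) (hPQ : VanPQ p q r A (n - 1)) (hPR : VanPR p q r A (n - 1)) {x x' : ℕ}
    (hx : x ≡ x' [MOD p ^ (n - 1)]) :
    (∀ k, ∑ j, wt p q r A n x j k = ∑ j, wt p q r A n x' j k) ∧
      ∀ j, ∑ k, wt p q r A n x j k = ∑ k, wt p q r A n x' j k := by
  have hn1 : n - 1 + 1 = n := by omega
  have key : ∀ {x x' : ℕ}, x ≡ x' [MOD p ^ (n - 1)] → ∀ k,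
      ∑ j, wt p q r A n x j k ≤ ∑ j, wt p q r A n x' j k := by
    intro x x' hx k
    by_contra! hlt
    have hval : ∀ k', ∑ j, wt p q r A n x j k' = 1 ∧ ∑ j, wt p q r A n x' j k' = 0 := by
      intro k'
      have := hPR x x' hx k k'
      rw [hn1] at this
      have a1 := hBA.sum_wt_le_one x k
      have a2 := hBA.sum_wt_le_one x' k
      have a3 := hBA.sum_wt_le_one x k'
      have a4 := hBA.sum_wt_le_one x' k'
      omega
    have hz : ∀ j, ∑ k, wt p q r A n x' j k = 0 := fun j =>
      Finset.sum_eq_zero fun k _ =>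
        (Finset.sum_eq_zero_iff_of_nonneg fun j _ => wt_nonneg p q r A n x' j k).mp (hval k).2 j
          (mem_univ j)
    have hm : ∀ j, ∑ k, wt p q r A n x j k = ∑ k, wt p q r A n x 0 k := by
      intro j
      have := hPQ x x' hx j 0
      rw [hn1, hz, hz] at this
      linarith
    have htot : ∑ j, ∑ k, wt p q r A n x j k = ∑ k, ∑ j, wt p q r A n x j k := Finset.sum_comm
    rw [Finset.sum_congr rfl fun j _ => hm j, Finset.sum_congr rfl fun k _ => (hval k).1] at htot
    simp only [Finset.sum_const, Finset.card_univ, ZMod.card, nsmul_eq_mul, mul_one] at htot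
    have hd : (q : ℤ) ∣ r := ⟨_, htot.symm⟩
    exact hqr ((Nat.prime_dvd_prime_iff_eq hq hr).mp (by exact_mod_cast hd))
  have hN : ∀ k, ∑ j, wt p q r A n x j k = ∑ j, wt p q r A n x' j k :=
    fun k => le_antisymm (key hx k) (key hx.symm k)
  refine ⟨hN, fun j => ?_⟩
  have htot : ∑ l, ∑ k, wt p q r A n x l k = ∑ l, ∑ k, wt p q r A n x' l k := by
    rw [Finset.sum_comm, Finset.sum_congr rfl fun k _ => hN k, Finset.sum_comm]
  have hd : ∀ l, ∑ k, wt p q r A n x l k - ∑ k, wt p q r A n x' l k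
      = ∑ k, wt p q r A n x j k - ∑ k, wt p q r A n x' j k := by
    intro l
    have := hPQ x x' hx j l
    rw [hn1] at this
    linarith
  have hs := Finset.sum_congr rfl fun l (_ : l ∈ (univ : Finset (ZMod q))) => hd l
  rw [Finset.sum_sub_distrib, htot, sub_self] at hs
  simp only [Finset.sum_const, Finset.card_univ, ZMod.card, nsmul_eq_mul] at hs
  have hq0 : (q : ℤ) ≠ 0 := by exact_mod_cast hq.ne_zero
  have := (mul_eq_zero.mp hs.symm).resolve_left hq0
  linarith

lemma CubePair.card_contra {g f h P : ℕ} (hp : 0 < p) (hq : q.Prime) (hr : r.Prime)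
    (hpq : Nat.Coprime p q) (hpr : Nat.Coprime p r) (hqr : q ≠ r) (hg : 0 < g) {C e : ℕ}
    (hP : P = p ^ e) (h1 : C = p * g + q * f) (h2 : C = p * g + r * h) (h3 : C = q * f + r * h)
    (hle : p * g ≤ P) (hdvd : P ∣ C) : False := by
  have hqg : q ∣ g := (Nat.Coprime.dvd_of_dvd_mul_left hpq.symm ⟨f, by omega⟩ : q ∣ g)
  have hrg : r ∣ g := (Nat.Coprime.dvd_of_dvd_mul_left hpr.symm ⟨h, by omega⟩ : r ∣ g)
  obtain ⟨s, rfl⟩ := Nat.Coprime.mul_dvd_of_dvd_of_dvd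
    ((Nat.coprime_primes hq hr).mpr hqr) hqg hrg
  have hC : C = q * r * (2 * (p * s)) := by
    have : C = 2 * (p * (q * r * s)) := by omega
    rw [this]; ring
  have hd : P ∣ 2 * (p * s) := by
    refine Nat.Coprime.dvd_of_dvd_mul_left ?_ (hC ▸ hdvd)
    rw [hP]
    exact Nat.Coprime.pow_left e (Nat.Coprime.mul_right hpq hpr)
  have hs : 0 < s := Nat.pos_of_ne_zero (by rintro rfl; simp at hg)
  have hps : 0 < p * s := by positivity
  have hle2 := Nat.le_of_dvd (by omega) hd
  have h6 : 4 < q * r * 1 := by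
    have := hq.two_le
    have := hr.two_le
    rcases lt_or_gt_of_ne hqr with h | h <;> nlinarith
  nlinarith

/-- The finest mixed characters of order divisible by `q * r` vanish. -/
lemma CubePair.vanPQR (H : CubePair p q r n A B) : VanPQR p q r A (n - 1) := by
  by_contra hcon
  obtain ⟨hp, hq, hr, hpq, hpr, hqr, hn, hAB, hBA, hcard, hne, hdig, hresQ, hresR, hnotP, -⟩ := H
  have : NeZero p := ⟨hp.ne_zero⟩
  have hn1 : n - 1 + 1 = n := by omega
  set f : ℕ → ZMod p := fun b => (b : ZMod p) with hf
  set g : ℕ → ZMod q := fun b => (b : ZMod q) with hg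
  set h : ℕ → ZMod r := fun b => (b : ZMod r) with hh
  have hfm : ∀ b b' : ℕ, f b = f b' ↔ b ≡ b' [MOD p] := fun b b' => ZMod.natCast_eq_natCast_iff b b' p
  have hpair : ∀ b ∈ B, ∀ b' ∈ B, f b = f b' ∨ g b = g b' ∨ h b = h b' := by
    intro b hb b' hb'
    by_contra! hc
    exact hcon (hAB.vanPQR b hb b' hb' 0 (n - 1) (by omega) (by simp [Nat.modEq_one])
      (by rw [zero_add, pow_one, ← hfm]; exact hc.1) hc.2.1 hc.2.2)
  have hf0 : ¬ ∀ b ∈ B, ∀ b' ∈ B, f b = f b' := by simpa only [hfm] using hdig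
  have hPQ : VanPQ p q r A (n - 1) := by
    by_contra hc
    rcases const_or_const_of_agree B f g (fun b hb b' hb' => by
      by_contra! hne
      refine hc (hAB.vanPQ b hb b' hb' 0 (n - 1) (by omega) (by simp [Nat.modEq_one])
        (by rw [zero_add, pow_one, ← hfm]; exact hne.1) hne.2 ?_)
      have := hpair b hb b' hb'
      tauto) with h1 | h1
    · exact hf0 h1
    · exact hresQ h1
  have hPR : VanPR p q r A (n - 1) := by
    by_contra hc
    rcases const_or_const_of_agree B f h (fun b hb b' hb' => by
      by_contra! hne
      refine hc (hAB.vanPR b hb b' hb' 0 (n - 1) (by omega) (by simp [Nat.modEq_one])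
        (by rw [zero_add, pow_one, ← hfm]; exact hne.1) ?_ hne.2)
      have := hpair b hb b' hb'
      tauto) with h1 | h1
    · exact hf0 h1
    · exact hresR h1
  have hinv := fun {x x'} => @proj_invariant p q r n _ _ A B hq hr hqr hBA hn hPQ hPR x x'
  have hI : n - 1 ∈ pLevels p q r n A := by
    refine mem_pLevels.mpr ⟨by omega, fun x x' hx => ?_⟩
    rw [hn1]
    exact Finset.sum_congr rfl fun j _ => (hinv hx).2 j
  obtain ⟨a, ha, x', hx', hzero⟩ := hnotP
  obtain ⟨a₁, ha₁, hm₁, hr₁⟩ : ∃ a₁ ∈ A, a₁ ≡ x' [MOD p ^ n] ∧ (a₁ : ZMod r) = a := by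
    have h1 := (hinv hx'.symm).1 (a : ZMod r)
    have h2 : ∑ j, wt p q r A n a j (a : ZMod r) ≠ 0 := by
      rw [sum_wt_left]
      exact_mod_cast (Finset.card_pos.mpr ⟨a, by simp [ha, Nat.ModEq.refl]⟩).ne'
    rw [h1, sum_wt_left] at h2
    obtain ⟨b, hb⟩ := Finset.card_pos.mp (Nat.pos_of_ne_zero (by exact_mod_cast h2))
    exact ⟨b, by simpa using hb⟩
  obtain ⟨a₂, ha₂, hm₂, hq₂⟩ : ∃ a₂ ∈ A, a₂ ≡ x' [MOD p ^ n] ∧ (a₂ : ZMod q) = a := by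
    have h1 := (hinv hx'.symm).2 (a : ZMod q)
    have h2 : ∑ k, wt p q r A n a (a : ZMod q) k ≠ 0 := by
      rw [sum_wt_right]
      exact_mod_cast (Finset.card_pos.mpr ⟨a, by simp [ha, Nat.ModEq.refl]⟩).ne'
    rw [h1, sum_wt_right] at h2
    obtain ⟨b, hb⟩ := Finset.card_pos.mp (Nat.pos_of_ne_zero (by exact_mod_cast h2))
    exact ⟨b, by simpa using hb⟩
  have hxa : ¬ x' ≡ a [MOD p ^ n] := by
    intro hxa
    rw [wt_congr hxa] at hzero
    exact wt_self_ne_zero ha n hzero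
  have hzero' : ∀ b ∈ A, b ≡ x' [MOD p ^ n] → (b : ZMod q) = a → (b : ZMod r) = a → False :=
    fun b hb h1 h2 h3 => wt_ne_zero_iff.mpr ⟨b, hb, h1, h2, h3⟩ hzero
  have hq₁ : (a₁ : ZMod q) ≠ a := fun hc => hzero' a₁ ha₁ hm₁ hc hr₁
  have hr₂ : (a₂ : ZMod r) ≠ a := fun hc => hzero' a₂ ha₂ hm₂ hq₂ hc
  have hBQ : MixVan B f g := mixVan_of_vanPQ (hBA.vanPQ a₁ ha₁ a ha (n - 1) 0 (by omega)
    ((hm₁.of_dvd (pow_dvd_pow p (by omega))).trans hx')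
    (by rw [hn1]; exact fun hc => hxa (hm₁.symm.trans hc)) hq₁ hr₁)
  have hBR : MixVan B f h := mixVan_of_vanPR (hBA.vanPR a₂ ha₂ a ha (n - 1) 0 (by omega)
    ((hm₂.of_dvd (pow_dvd_pow p (by omega))).trans hx')
    (by rw [hn1]; exact fun hc => hxa (hm₂.symm.trans hc)) hq₂ hr₂)
  have hQR : MixVan B g h := mixVan_of_vanQR (hBA.vanQR a₁ ha₁ a₂ ha₂ (hm₁.trans hm₂.symm)
    (by rw [hq₂]; exact hq₁) (by rw [hr₁]; exact hr₂.symm))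
  by_cases hmaj : ∃ a b c, Majority B f g h a b c
  · obtain ⟨d₀, j₀, k₀, hmaj⟩ := hmaj
    obtain ⟨b₁, hb₁, hd₁⟩ : ∃ b ∈ B, f b ≠ d₀ := by
      by_contra! hc
      exact hf0 fun b hb b' hb' => (hc b hb).trans (hc b' hb').symm
    obtain ⟨b₂, hb₂, hj₁⟩ : ∃ b ∈ B, g b ≠ j₀ := by
      by_contra! hc
      exact hresQ fun b hb b' hb' => (hc b hb).trans (hc b' hb').symm
    obtain ⟨b₃, hb₃, hk₁⟩ : ∃ b ∈ B, h b ≠ k₀ := by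
      by_contra! hc
      exact hresR fun b hb b' hb' => (hc b hb).trans (hc b' hb').symm
    have c1 := hBQ.card_eq (fun x hx => by have := hmaj x hx; tauto) hd₁ hj₁
    have c2 := hBR.card_eq (fun x hx => by have := hmaj x hx; tauto) hd₁ hk₁
    have c3 := hQR.card_eq (fun x hx => by have := hmaj x hx; tauto) hj₁ hk₁
    simp only [ZMod.card] at c1 c2 c3
    have hX := hAB.card_le hp.pos (n - 1) (by omega) (B.filter fun b => f b = f b₁)
      (filter_subset _ _)
      (fun x hx y hy => by
        have h1 := hmaj x (mem_filter.mp hx).1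
        have h2 := hmaj y (mem_filter.mp hy).1
        have h3 := (mem_filter.mp hx).2
        have h4 := (mem_filter.mp hy).2
        change g x = g y
        grind)
      (fun x hx y hy => by
        have h1 := hmaj x (mem_filter.mp hx).1
        have h2 := hmaj y (mem_filter.mp hy).1
        have h3 := (mem_filter.mp hx).2
        have h4 := (mem_filter.mp hy).2
        change h x = h y
        grind)
      (fun x hx y hy => by
        have h3 := (mem_filter.mp hx).2
        have h4 := (mem_filter.mp hy).2
        rw [show n - (n - 1) = 1 by omega, pow_one, ← hfm, h3, h4])
    have hIc := card_filter_lt_succ (pLevels p q r n A) (n - 1)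
    rw [if_pos hI, hn1, Finset.filter_true_of_mem
      (fun i hi => (mem_pLevels.mp hi).1)] at hIc
    refine CubePair.card_contra hp.pos hq hr ((Nat.coprime_primes hp hq).mpr hpq)
      ((Nat.coprime_primes hp hr).mpr hpr) hqr
      (Finset.card_pos.mpr ⟨b₁, by simp [hb₁]⟩) rfl c1 c2 c3 ?_
      (hcard ▸ pow_card_pLevels_dvd (q := q) (r := r) (n := n) (A := A) hp.pos)
    rw [hIc, pow_succ']
    exact Nat.mul_le_mul_left p hX
  · have hpair2 : ∀ x ∈ B, ∀ y ∈ B, g x = g y ∨ f x = f y ∨ h x = h y := fun x hx y hy => by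
      have := hpair x hx y hy; tauto
    have hpair3 : ∀ x ∈ B, ∀ y ∈ B, h x = h y ∨ f x = f y ∨ g x = g y := fun x hx y hy => by
      have := hpair x hx y hy; tauto
    have m1 : 3 ≤ p → ∃ d, ∀ x ∈ B, f x ≠ d := fun h3 => exists_not_image B f (by rwa [ZMod.card])
      fun x hx y hy z hz h1 h2 h3 => hmaj
        (majority_of_three_values B f g h hpair hresQ hresR hx hy hz h1 h2 h3)
    have m2 : 3 ≤ q → ∃ d, ∀ x ∈ B, g x ≠ d := fun h3 => exists_not_image B g (by rwa [ZMod.card])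
      fun x hx y hy z hz h1 h2 h3 => by
        obtain ⟨b, a, c, hm⟩ := majority_of_three_values B g f h hpair2 hf0 hresR hx hy hz h1 h2 h3
        exact hmaj ⟨a, b, c, fun v hv => by have := hm v hv; tauto⟩
    have m3 : 3 ≤ r → ∃ d, ∀ x ∈ B, h x ≠ d := fun h3 => exists_not_image B h (by rwa [ZMod.card])
      fun x hx y hy z hz h1 h2 h3 => by
        obtain ⟨c, a, b, hm⟩ := majority_of_three_values B h f g hpair3 hf0 hresQ hx hy hz h1 h2 h3
        exact hmaj ⟨a, b, c, fun v hv => by have := hm v hv; tauto⟩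
    have e1 := hp.two_le
    have e2 := hq.two_le
    have e3 := hr.two_le
    rcases (by omega : (3 ≤ p ∧ 3 ≤ q) ∨ (3 ≤ p ∧ 3 ≤ r) ∨ (3 ≤ q ∧ 3 ≤ r)) with h' | h' | h'
    · obtain ⟨d, hd⟩ := m1 h'.1
      obtain ⟨j, hj⟩ := m2 h'.2
      exact hne.ne_empty (hBQ.eq_empty hd hj)
    · obtain ⟨d, hd⟩ := m1 h'.1
      obtain ⟨j, hj⟩ := m3 h'.2
      exact hne.ne_empty (hBR.eq_empty hd hj)
    · obtain ⟨d, hd⟩ := m2 h'.1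
      obtain ⟨j, hj⟩ := m3 h'.2
      exact hne.ne_empty (hQR.eq_empty hd hj)

end

section

variable {p q r n : ℕ} [NeZero q] [NeZero r] {A B : Finset ℕ}

lemma not_modEq_add_mul {p : ℕ} (i x : ℕ) {s t : ℕ} (hs : s < p) (ht : t < p) (hst : s ≠ t) :
    ¬ x + s * p ^ i ≡ x + t * p ^ i [MOD p ^ (i + 1)] := by
  intro h
  have h := Nat.ModEq.add_left_cancel' x h
  rw [pow_succ'] at h
  have h3 : s ≡ t [MOD p] := Nat.ModEq.mul_right_cancel' (pow_pos (by omega) i).ne' h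
  exact hst (Nat.ModEq.eq_of_lt_of_lt h3 hs ht)

lemma add_mul_modEq (p i x t : ℕ) : x + t * p ^ i ≡ x [MOD p ^ i] := by
  simp [Nat.ModEq]

/-- Two points of `A` differing only in a `p`-digit are forced by a row that varies in the
`r`-direction. -/
lemma DiffVanish.vanP_of_not_const (h : DiffVanish p q r n B A) (hp : p.Prime) (hq : q.Prime)
    (hpq : p ≠ q) {m e : ℕ} (hm : m + e + 1 = n) (c : ℤ) (hc : 0 < c) (x : ℕ)
    (hw : ∀ y, y ≡ x [MOD p ^ m] → ∀ j k, wt p q r A (m + 1) y j k = 0 ∨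
      wt p q r A (m + 1) y j k = c)
    (hw1 : ∀ y, y ≡ x [MOD p ^ m] → ∀ j l k, wt p q r A (m + 1) y j k ≠ 0 →
      wt p q r A (m + 1) y l k ≠ 0 → j = l)
    (hmix : VanPQR p q r A m) (j : ZMod q) (k k' : ZMod r)
    (h1 : wt p q r A (m + 1) x j k = c) (h2 : wt p q r A (m + 1) x j k' = 0) :
    VanP p q r B e := by
  have hx : ∀ t, x + t * p ^ m ≡ x [MOD p ^ m] := add_mul_modEq p m x
  obtain ⟨k₀, l, t₁, t₂, ht, e1, e2⟩ := grid_two_points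
    (fun (k : ZMod r) (j : ZMod q) (t : Fin p) => wt p q r A (m + 1) (x + t * p ^ m) j k) c hc
    (fun k j t => hw _ (hx t) j k) (fun k j l t => hw1 _ (hx t) j l k)
    (fun k k' j l t t' => by
      have := hmix _ _ ((hx t).trans (hx t').symm) j l k k'
      linarith)
    (by rw [ZMod.card]; exact hq.two_le) (by rw [Fintype.card_fin]; exact hp.two_le)
    (by rw [ZMod.card, Fintype.card_fin]; exact hpq.symm) k k' j ⟨0, hp.pos⟩
    (by simpa using h1) (by simpa using h2)
  obtain ⟨a₁, ha₁, m₁, q₁, r₁⟩ := wt_ne_zero_iff.mp (by rw [e1]; exact hc.ne')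
  obtain ⟨a₂, ha₂, m₂, q₂, r₂⟩ := wt_ne_zero_iff.mp (by rw [e2]; exact hc.ne')
  refine h.vanP a₁ ha₁ a₂ ha₂ m e hm ?_ ?_ (q₁.trans q₂.symm) (r₁.trans r₂.symm)
  · have hd := pow_dvd_pow p (Nat.le_succ m)
    exact (m₁.of_dvd hd).trans ((hx t₁).trans ((hx t₂).symm.trans (m₂.of_dvd hd).symm))
  · intro hc
    exact not_modEq_add_mul m x t₁.2 t₂.2 (fun h => ht (Fin.ext h))
      (m₁.symm.trans (hc.trans m₂))

/-- Slices of equal size, each confined to a single digit, cannot be equidistributed. -/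
lemma false_of_vanP_of_slices (hp : p.Prime) (hr : r.Prime) (hpr : p ≠ r) (e c s : ℕ) (hs : 0 < s)
    (hcard : ∀ k : ZMod r, (B.filter fun b => b ≡ c [MOD p ^ e] ∧ (b : ZMod r) = k).card = s)
    (hdig : ∀ b ∈ B, ∀ b' ∈ B, b ≡ c [MOD p ^ e] → b' ≡ c [MOD p ^ e] → (b : ZMod r) = b' →
      b ≡ b' [MOD p ^ (e + 1)])
    (hV : VanP p q r B e) : False := by
  have htot : (B.filter (· ≡ c [MOD p ^ e])).card = r * s := by
    rw [Finset.card_eq_sum_card_fiberwise (f := fun a : ℕ => (a : ZMod r)) (t := univ) (by simp)]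
    simp only [Finset.filter_filter, hcard]
    simp [ZMod.card]
  have hdvd : s ∣ (B.filter (· ≡ c [MOD p ^ (e + 1)])).card := by
    rw [Finset.card_eq_sum_card_fiberwise (f := fun a : ℕ => (a : ZMod r)) (t := univ) (by simp)]
    refine Finset.dvd_sum fun k _ => ?_
    rw [Finset.filter_filter]
    rcases (B.filter fun b => b ≡ c [MOD p ^ (e + 1)] ∧ (b : ZMod r) = k).eq_empty_or_nonempty with
      h0 | ⟨b₀, hb₀⟩
    · rw [h0]; simp
    · rw [mem_filter] at hb₀
      have hd := pow_dvd_pow p (Nat.le_succ e)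
      rw [show (B.filter fun b => b ≡ c [MOD p ^ (e + 1)] ∧ (b : ZMod r) = k)
        = B.filter fun b => b ≡ c [MOD p ^ e] ∧ (b : ZMod r) = k from
        Finset.filter_congr fun b hb => ⟨fun h => ⟨h.1.of_dvd hd, h.2⟩, fun h =>
          ⟨(hdig b hb b₀ hb₀.1 h.1 (hb₀.2.1.of_dvd hd) (h.2.trans hb₀.2.2.symm)).trans hb₀.2.1,
            h.2⟩⟩, hcard]
  obtain ⟨u, hu⟩ := hdvd
  have hsum := card_filter_modEq_split hp.pos B e c
  rw [Finset.sum_congr rfl (g := fun _ => s * u) fun t _ => by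
    have := hV (c + t * p ^ e) c (add_mul_modEq p e c t)
    rw [sum_sum_wt, sum_sum_wt] at this
    rw [← hu]
    exact_mod_cast this] at hsum
  rw [htot, Finset.sum_const, card_range, smul_eq_mul] at hsum
  have : r = p * u := Nat.eq_of_mul_eq_mul_right hs (by rw [hsum]; ring)
  exact hpr ((Nat.prime_dvd_prime_iff_eq hp hr).mp ⟨u, this⟩)

lemma mixed_eq_zero {i : ℕ} (hPQ : VanPQ p q r A i) (hPQR : VanPQR p q r A i) {x x' : ℕ}
    (hx : x ≡ x' [MOD p ^ i]) (j l : ZMod q) (k : ZMod r) :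
    wt p q r A (i + 1) x j k - wt p q r A (i + 1) x l k
      - wt p q r A (i + 1) x' j k + wt p q r A (i + 1) x' l k = 0 := by
  have h := hPQ x x' hx j l
  rw [← Finset.sum_sub_distrib, ← Finset.sum_sub_distrib, ← Finset.sum_add_distrib,
    Finset.sum_congr rfl fun k' _ => hPQR x x' hx j l k' k] at h
  simp only [Finset.sum_const, Finset.card_univ, ZMod.card, nsmul_eq_mul] at h
  exact (mul_eq_zero.mp h).resolve_left (by exact_mod_cast NeZero.ne r)

namespace CubePair

lemma vanR (H : CubePair p q r n A B) : VanR p q r B := by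
  have hn1 : n - 1 + 1 = n := by have := H.hn; omega
  obtain ⟨a, ha, x', hx', hz⟩ := H.notP
  have hw := H.hBA.wt_eq_zero_or_one
  obtain ⟨y, l, k₁, k₂, hk, e1, e2⟩ := grid_two_points
    (fun (x : {y : ℕ // y ≡ a [MOD p ^ (n - 1)]}) j k => wt p q r A n x j k) 1 one_pos
    (fun x j k => hw x j k) (fun x j l k => H.hBA.wt_unique x j l k)
    (fun x x' j l k k' => by
      have := H.vanPQR x x' (x.2.trans x'.2.symm) j l k k'
      rwa [hn1] at this)
    (by rw [ZMod.card]; exact H.hq.two_le) (by rw [ZMod.card]; exact H.hr.two_le)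
    (by rw [ZMod.card, ZMod.card]; exact H.hqr) ⟨a, rfl⟩ ⟨x', hx'⟩ a a
    ((hw a a a).resolve_left (wt_self_ne_zero ha n)) hz
  obtain ⟨a₁, ha₁, m₁, q₁, r₁⟩ := wt_ne_zero_iff.mp (by rw [e1]; exact one_ne_zero)
  obtain ⟨a₂, ha₂, m₂, q₂, r₂⟩ := wt_ne_zero_iff.mp (by rw [e2]; exact one_ne_zero)
  exact H.hBA.vanR a₁ ha₁ a₂ ha₂ (m₁.trans m₂.symm) (q₁.trans q₂.symm) (by rw [r₁, r₂]; exact hk)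

lemma vanP_zero (H : CubePair p q r n A B) : VanP p q r B 0 := by
  have hn1 : n - 1 + 1 = n := by have := H.hn; omega
  obtain ⟨a, ha, k', hz⟩ := H.notR
  have hw := H.hBA.wt_eq_zero_or_one
  refine H.hBA.vanP_of_not_const H.hp H.hq H.hpq (m := n - 1) (by omega) 1 one_pos a ?_ ?_
    H.vanPQR a a k' ?_ ?_
  · rw [hn1]; exact fun y _ j k => hw y j k
  · rw [hn1]; exact fun y _ j l k => H.hBA.wt_unique y j l k
  · rw [hn1]; exact (hw a a a).resolve_left (wt_self_ne_zero ha n)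
  · rw [hn1]; exact hz

lemma exists_card_slice (H : CubePair p q r n A B) : ∃ s, 0 < s ∧ B.card = r * s ∧
    ∀ k : ZMod r, (B.filter fun b : ℕ => (b : ZMod r) = k).card = s := by
  have hR : ∀ k : ZMod r, (B.filter fun b : ℕ => (b : ZMod r) = k).card
      = (B.filter fun b : ℕ => (b : ZMod r) = 0).card := by
    intro k
    have := H.vanR k 0
    rw [sum_wt_left, sum_wt_left] at this
    simpa [Nat.modEq_one] using this
  have htot : B.card = r * (B.filter fun b : ℕ => (b : ZMod r) = 0).card := by
    rw [Finset.card_eq_sum_card_fiberwise (f := fun a : ℕ => (a : ZMod r)) (t := univ) (by simp)]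
    simp only [hR]
    simp [ZMod.card]
  refine ⟨_, ?_, htot, hR⟩
  have := H.nonempty.card_pos
  exact Nat.pos_of_ne_zero fun h0 => by rw [h0] at htot; omega

lemma not_vanPQ (H : CubePair p q r n A B) : ¬ VanPQ p q r A (n - 1) := by
  intro hPQ
  have hn1 : n - 1 + 1 = n := by have := H.hn; omega
  have := Fact.mk H.hq.one_lt
  obtain ⟨a, ha, x', hx', hz⟩ := H.notP
  obtain ⟨l, hl⟩ := exists_ne (a : ZMod q)
  have h := mixed_eq_zero hPQ H.vanPQR hx'.symm a l a
  rw [hn1, hz] at h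
  have h1 := (H.hBA.wt_eq_zero_or_one a a a).resolve_left (wt_self_ne_zero ha n)
  have h2 : wt p q r A n a l a = 0 := by
    by_contra h2
    exact hl (H.hBA.wt_unique a l a a h2 (wt_self_ne_zero ha n))
  have := wt_nonneg p q r A n x' l a
  omega

lemma exists_two_digits (H : CubePair p q r n A B) :
    ∃ b ∈ B, ∃ b' ∈ B, (b : ZMod r) = b' ∧ ¬ b ≡ b' [MOD p] := by
  obtain ⟨s, hs, -, hcard⟩ := H.exists_card_slice
  by_contra! hc
  refine false_of_vanP_of_slices (q := q) H.hp H.hr H.hpr 0 0 s hs ?_ ?_ H.vanP_zero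
  · simpa [Nat.modEq_one] using hcard
  · intro b hb b' hb' _ _ h
    simpa using hc b hb b' hb' h

lemma label_of_digit (H : CubePair p q r n A B) {b b' : ℕ} (hb : b ∈ B) (hb' : b' ∈ B)
    (hr : (b : ZMod r) = b') (hd : ¬ b ≡ b' [MOD p]) : (b : ZMod q) = b' := by
  by_contra hq
  exact H.not_vanPQ (H.hAB.vanPQ b hb b' hb' 0 (n - 1) (by have := H.hn; omega)
    (by simp [Nat.modEq_one]) (by simpa using hd) hq hr)

lemma vanP_last (H : CubePair p q r n A B) : VanP p q r A (n - 1) := by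
  obtain ⟨b, hb, b', hb', hr, hd⟩ := H.exists_two_digits
  exact H.hAB.vanP b hb b' hb' 0 (n - 1) (by have := H.hn; omega)
    (by simp [Nat.modEq_one]) (by simpa using hd) (H.label_of_digit hb hb' hr hd) hr

lemma mixed_zero (H : CubePair p q r n A B) (x x' : ℕ) (j l : ZMod q) (k : ZMod r) :
    wt p q r B 1 x j k - wt p q r B 1 x l k - wt p q r B 1 x' j k + wt p q r B 1 x' l k = 0 := by
  have hn1 : n - 1 + 1 = n := by have := H.hn; omega
  have := Fact.mk H.hr.one_lt
  obtain ⟨a, ha, y, hy, hz⟩ := H.notP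
  have hw := H.hBA.wt_eq_zero_or_one
  have hya : ¬ a ≡ y [MOD p ^ n] := fun h => by
    rw [← wt_congr h] at hz
    exact wt_self_ne_zero ha n hz
  obtain ⟨-, j', hj', hline⟩ := grid_core (fun j k => wt p q r A n a j k)
    (fun j k => wt p q r A n y j k) 1 (hw a) (hw y) one_pos
    (fun j l k => H.hBA.wt_unique a j l k)
    (fun j l k k' => by
      have := H.vanPQR a y hy.symm j l k k'
      rwa [hn1] at this)
    (by have := H.vanP_last a y hy.symm; rwa [hn1] at this)
    (by rw [ZMod.card]; exact H.hq.two_le)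
    (by
      rw [ZMod.card, ZMod.card, mul_one, Nat.isCoprime_iff_coprime]
      exact (Nat.coprime_primes H.hq H.hr).mpr H.hqr) a a
    ((hw a a a).resolve_left (wt_self_ne_zero ha n)) hz
  have hpt : ∀ k : ZMod r, ∃ b ∈ A, a ≡ b [MOD p ^ (n - 1)] ∧ ¬ a ≡ b [MOD p ^ (n - 1 + 1)] ∧
      (a : ZMod q) ≠ b ∧ (b : ZMod r) = k := by
    intro k
    obtain ⟨b, hb, hb1, hb2, hb3⟩ := wt_ne_zero_iff.mp
      (show wt p q r A n y j' k ≠ 0 by rw [hline]; exact one_ne_zero)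
    refine ⟨b, hb, hy.symm.trans (hb1.symm.of_dvd (pow_dvd_pow p (by omega))), ?_, ?_, hb3⟩
    · rw [hn1]; exact fun h => hya (h.trans hb1)
    · rw [hb2]; exact hj'.symm
  have hPQ : VanPQ p q r B 0 := by
    obtain ⟨b, hb, h1, h2, h3, h4⟩ := hpt a
    exact H.hBA.vanPQ a ha b hb (n - 1) 0 (by omega) h1 h2 h3 h4.symm
  have hPQR : VanPQR p q r B 0 := by
    obtain ⟨k', hk'⟩ := exists_ne (a : ZMod r)
    obtain ⟨b, hb, h1, h2, h3, h4⟩ := hpt k'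
    exact H.hBA.vanPQR a ha b hb (n - 1) 0 (by omega) h1 h2 h3 (by rw [h4]; exact hk'.symm)
  exact mixed_eq_zero hPQ hPQR (by simp [Nat.modEq_one]) j l k

lemma card_slice (H : CubePair p q r n A B) (k : ZMod r) :
    (B.filter fun b : ℕ => (b : ZMod r) = k).card = p ^ (pLevels p q r n A).card := by
  obtain ⟨s, hs, htot, hcard⟩ := H.exists_card_slice
  obtain ⟨b, hb, b', hb', hr, hd⟩ := H.exists_two_digits
  have hlab : ∀ x ∈ B.filter (fun x : ℕ => (x : ZMod r) = b), (x : ZMod q) = b := by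
    intro x hx
    rw [mem_filter] at hx
    by_cases hxb : x ≡ b [MOD p]
    · rw [H.label_of_digit hb hb' hr hd]
      exact H.label_of_digit hx.1 hb' (hx.2.trans hr) fun h => hd (hxb.symm.trans h)
    · exact H.label_of_digit hx.1 hb hx.2 hxb
  have hle := H.hAB.card_le H.hp.pos n le_rfl (B.filter fun x : ℕ => (x : ZMod r) = b)
    (filter_subset _ _) (fun x hx y hy => (hlab x hx).trans (hlab y hy).symm)
    (fun x hx y hy => (mem_filter.mp hx).2.trans (mem_filter.mp hy).2.symm)
    (by simp [Nat.modEq_one])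
  rw [hcard, Finset.filter_true_of_mem fun i hi => (mem_pLevels.mp hi).1] at hle
  rw [hcard]
  refine le_antisymm hle (Nat.le_of_dvd hs ?_)
  have hd := pow_card_pLevels_dvd (p := p) (q := q) (r := r) (n := n) (A := A) H.hp.pos
  rw [H.card_eq, htot] at hd
  exact Nat.Coprime.dvd_of_dvd_mul_left
    (Nat.Coprime.pow_left _ ((Nat.coprime_primes H.hp H.hr).mpr H.hpr)) hd

/-- In each slice of `B` modulo `r` the residue modulo `q` is constant. -/
lemma label_eq (H : CubePair p q r n A B) {b b' : ℕ} (hb : b ∈ B) (hb' : b' ∈ B)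
    (hr : (b : ZMod r) = b') : (b : ZMod q) = b' := by
  by_contra hq
  have hd : ∀ x ∈ B, (x : ZMod r) = b → x ≡ b [MOD p] := by
    intro x hx hxr
    by_contra hxb
    have hbb' : b ≡ b' [MOD p] := by
      by_contra h
      exact hq (H.label_of_digit hb hb' hr h)
    have h1 := H.label_of_digit hx hb hxr hxb
    have h2 := H.label_of_digit hx hb' (hxr.trans hr) fun h => hxb (h.trans hbb'.symm)
    exact hq (h1.symm.trans h2)
  have hz : ∀ j, wt p q r B 1 (b + 1) j b = 0 := by
    intro j
    by_contra hne
    obtain ⟨x, hx, h1, -, h2⟩ := wt_ne_zero_iff.mp hne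
    have h3 := (hd x hx h2).symm.trans (by simpa using h1)
    have h4 := not_modEq_add_mul (p := p) 0 b (s := 0) (t := 1) H.hp.pos H.hp.one_lt zero_ne_one
    simp only [add_zero, pow_zero, mul_one, zero_add, pow_one] at h4
    exact h4 h3
  have hsum : ∑ j, wt p q r B 1 b j b = p ^ (pLevels p q r n A).card := by
    rw [sum_wt_left, ← Nat.cast_pow, ← H.card_slice b]
    congr 2
    refine Finset.filter_congr fun x hx => ⟨fun h => h.2, fun h => ⟨by simpa using hd x hx h, h⟩⟩
  rw [Finset.sum_congr rfl fun j _ => show wt p q r B 1 b j b = wt p q r B 1 b 0 b by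
    have := H.mixed_zero b (b + 1) j 0 b
    rw [hz, hz] at this
    linarith] at hsum
  simp only [Finset.sum_const, Finset.card_univ, ZMod.card, nsmul_eq_mul] at hsum
  have h5 : (q : ℤ) ∣ (p ^ (pLevels p q r n A).card : ℕ) := ⟨_, by push_cast; exact hsum.symm⟩
  exact H.hpq ((Nat.prime_dvd_prime_iff_eq H.hq H.hp).mp
    (H.hq.dvd_of_dvd_pow (by exact_mod_cast h5))).symm

end CubePair

end

section

variable {p q r n : ℕ} [NeZero q] [NeZero r] {A B : Finset ℕ}

/-- The row over `x` does not depend on the residue modulo `r`. -/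
def FlatRow (p q r : ℕ) (A : Finset ℕ) (i x : ℕ) : Prop :=
  ∀ j k k', wt p q r A i x j k = wt p q r A i x j k'

/-- The row over `x` has weights `0` or `c`, at most one of them nonzero for each residue
modulo `r`. -/
def PointRow (p q r : ℕ) (A : Finset ℕ) (i : ℕ) (c : ℤ) (x : ℕ) : Prop :=
  (∀ j k, wt p q r A i x j k = 0 ∨ wt p q r A i x j k = c) ∧
    ∀ j l k, wt p q r A i x j k ≠ 0 → wt p q r A i x l k ≠ 0 → j = l

/-- The slices modulo `r` are equidistributed in the `i`-th digit. -/
def SliceVan (p q r : ℕ) [NeZero q] (A : Finset ℕ) (i : ℕ) : Prop :=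
  ∀ x x', x ≡ x' [MOD p ^ i] → ∀ k,
    ∑ j, wt p q r A (i + 1) x j k = ∑ j, wt p q r A (i + 1) x' j k

lemma FlatRow.merge (hp : 0 < p) {i x : ℕ}
    (h : ∀ t < p, FlatRow p q r A (i + 1) (x + t * p ^ i)) : FlatRow p q r A i x := by
  intro j k k'
  rw [wt_split hp, wt_split hp]
  exact Finset.sum_congr rfl fun t ht => h t (mem_range.mp ht) j k k'

lemma FlatRow.sum_eq {i x x' : ℕ} (hV : VanP p q r A i) (hx : x ≡ x' [MOD p ^ i])
    (h : FlatRow p q r A (i + 1) x) (h' : FlatRow p q r A (i + 1) x') (k : ZMod r) :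
    ∑ j, wt p q r A (i + 1) x j k = ∑ j, wt p q r A (i + 1) x' j k := by
  have e : ∀ y, FlatRow p q r A (i + 1) y → ∑ j, ∑ k, wt p q r A (i + 1) y j k
      = r * ∑ j, wt p q r A (i + 1) y j k := by
    intro y hy
    rw [Finset.mul_sum]
    refine Finset.sum_congr rfl fun j _ => ?_
    rw [Finset.sum_congr rfl fun k' _ => hy j k' k]
    simp [ZMod.card]
  have := hV x x' hx
  rw [e x h, e x' h'] at this
  exact mul_left_cancel₀ (by exact_mod_cast NeZero.ne r) this

lemma FlatRow.of_adj (hq : q.Prime) {i x x' : ℕ} {c : ℤ} (hc : 0 < c) (hV : VanPQR p q r A i)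
    (hx : x ≡ x' [MOD p ^ i]) (h : FlatRow p q r A (i + 1) x)
    (h' : FlatRow p q r A (i + 1) x' ∨ PointRow p q r A (i + 1) c x') :
    FlatRow p q r A (i + 1) x' := by
  rcases h' with h' | h'
  · exact h'
  · have := Fact.mk hq.one_lt
    exact grid_const_adj (fun j k => wt p q r A (i + 1) x j k)
      (fun j k => wt p q r A (i + 1) x' j k) c h'.1 hc h'.2 (fun j l k k' => hV x x' hx j l k k') h

lemma PointRow.dichotomy (hp : p.Prime) (hq : q.Prime) (hr : r.Prime) (hpq : p ≠ q) (hqr : q ≠ r)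
    {i x x' e : ℕ} (hV : VanPQR p q r A i) (hP : VanP p q r A i) (hx : x ≡ x' [MOD p ^ i])
    (h : PointRow p q r A (i + 1) (p ^ e) x) (h' : PointRow p q r A (i + 1) (p ^ e) x') :
    (∀ j k, wt p q r A (i + 1) x j k = wt p q r A (i + 1) x' j k) ∨
      (FlatRow p q r A (i + 1) x ∧ FlatRow p q r A (i + 1) x') := by
  have hc : (0 : ℤ) < p ^ e := pow_pos (by exact_mod_cast hp.pos) e
  rcases grid_dichotomy (fun j k => wt p q r A (i + 1) x j k)
    (fun j k => wt p q r A (i + 1) x' j k) _ h.1 h'.1 hc h.2 h'.2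
    (fun j l k k' => hV x x' hx j l k k') (hP x x' hx) (by rw [ZMod.card]; exact hq.two_le)
    (by
      rw [ZMod.card, ZMod.card]
      have : Nat.Coprime q (r * p ^ e) := Nat.Coprime.mul_right
        ((Nat.coprime_primes hq hr).mpr hqr)
        (Nat.Coprime.pow_right _ ((Nat.coprime_primes hq hp).mpr hpq.symm))
      exact_mod_cast Nat.isCoprime_iff_coprime.mpr this) with h0 | h0
  · exact Or.inl fun j k => congrFun (congrFun h0 j) k
  · exact Or.inr h0

/-- The inductive state of the descent through the levels. -/
def LevelInv (p q r n : ℕ) [NeZero q] [NeZero r] (A B : Finset ℕ) (i : ℕ) : Prop :=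
  (∀ x, FlatRow p q r A i x ∨
    PointRow p q r A i (p ^ ((pLevels p q r n A).filter (i ≤ ·)).card) x) ∧
  ((∀ x, FlatRow p q r A i x) ∨ ∃ c, ∀ k : ZMod r,
    (B.filter fun b => b ≡ c [MOD p ^ (n - i)] ∧ (b : ZMod r) = k).card
      = p ^ ((pLevels p q r n A).filter (· < i)).card)

namespace CubePair

lemma levelInv_top (H : CubePair p q r n A B) : LevelInv p q r n A B n := by
  have h0 : (pLevels p q r n A).filter (n ≤ ·) = ∅ :=
    Finset.filter_false_of_mem fun i hi => by have := (mem_pLevels.mp hi).1; omega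
  refine ⟨fun x => Or.inr ⟨fun j k => ?_, fun j l k => H.hBA.wt_unique x j l k⟩, Or.inr ⟨0, ?_⟩⟩
  · rw [h0, card_empty, pow_zero]
    exact H.hBA.wt_eq_zero_or_one x j k
  · intro k
    rw [Finset.filter_true_of_mem fun i hi => (mem_pLevels.mp hi).1]
    simpa [Nat.modEq_one] using H.card_slice k

lemma exists_label_ne (H : CubePair p q r n A B) (j : ZMod q) : ∃ b ∈ B, (b : ZMod q) ≠ j := by
  by_contra! hc
  exact H.resQ fun b hb b' hb' => (hc b hb).trans (hc b' hb').symm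

/-- One step of the descent at a level in `pLevels`, in the presence of a full class of `B`. -/
lemma levelInv_step_mem (H : CubePair p q r n A B) {m e c : ℕ} (hm : m + e + 1 = n)
    (hI : m ∈ pLevels p q r n A)
    (hrow : ∀ x, FlatRow p q r A (m + 1) x ∨
      PointRow p q r A (m + 1) (p ^ ((pLevels p q r n A).filter (m + 1 ≤ ·)).card) x)
    (hcl : ∀ k : ZMod r, (B.filter fun b => b ≡ c [MOD p ^ e] ∧ (b : ZMod r) = k).card
      = p ^ ((pLevels p q r n A).filter (· < m + 1)).card) :
    LevelInv p q r n A B m ∧ SliceVan p q r A m := by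
  have hp := H.hp
  have hne1 : n - (m + 1) = e := by omega
  have hne2 : n - m = e + 1 := by omega
  have hcl' : ∀ (k : ZMod r) (t : ℕ), t < p → (B.filter fun b => b ≡ c + t * p ^ e [MOD p ^ (e + 1)]
      ∧ (b : ZMod r) = k).card = p ^ ((pLevels p q r n A).filter (· < m)).card := by
    intro k t ht
    have := H.hAB.card_filter_eq hp.pos m (by omega)
      (B.filter fun b => b ≡ c [MOD p ^ e] ∧ (b : ZMod r) = k) (filter_subset _ _)
      (fun x hx y hy => H.label_eq (mem_filter.mp hx).1 (mem_filter.mp hy).1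
        ((mem_filter.mp hx).2.2.trans (mem_filter.mp hy).2.2.symm))
      (fun x hx y hy => (mem_filter.mp hx).2.2.trans (mem_filter.mp hy).2.2.symm) c
      (fun x hx => by rw [hne1]; exact (mem_filter.mp hx).2.1) (hcl k) hI t ht
    rw [← this, hne1, hne2, Finset.filter_filter]
    congr 1
    refine Finset.filter_congr fun b _ => ⟨fun h => ⟨⟨?_, h.2⟩, h.1⟩, fun h => ⟨h.2, h.1.2⟩⟩
    exact (h.1.of_dvd (pow_dvd_pow p (Nat.le_succ e))).trans (add_mul_modEq p e c t)
  have hpt : ∀ (k : ZMod r) (t : ℕ), t < p → ∃ b ∈ B, b ≡ c + t * p ^ e [MOD p ^ (e + 1)] ∧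
      (b : ZMod r) = k := by
    intro k t ht
    have h1 : 0 < (B.filter fun b => b ≡ c + t * p ^ e [MOD p ^ (e + 1)]
      ∧ (b : ZMod r) = k).card := by rw [hcl' k t ht]; exact pow_pos hp.pos _
    obtain ⟨b, hb⟩ := Finset.card_pos.mp h1
    exact ⟨b, by simpa using hb⟩
  have hPQR : VanPQR p q r A m := by
    obtain ⟨b, hb⟩ := H.nonempty
    obtain ⟨b', hb', hne⟩ := H.exists_label_ne b
    obtain ⟨b₁, hb₁, hm₁, hr₁⟩ := hpt b 0 hp.pos
    obtain ⟨b₂, hb₂, hm₂, hr₂⟩ := hpt b' 1 hp.one_lt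
    have hq₁ := H.label_eq hb₁ hb hr₁
    have hq₂ := H.label_eq hb₂ hb' hr₂
    have hd := pow_dvd_pow p (Nat.le_succ e)
    refine H.hAB.vanPQR b₁ hb₁ b₂ hb₂ e m (by omega) ?_ ?_ ?_ ?_
    · exact ((hm₁.of_dvd hd).trans (add_mul_modEq p e c 0)).trans
        ((hm₂.of_dvd hd).trans (add_mul_modEq p e c 1)).symm
    · exact fun h => not_modEq_add_mul e c hp.pos hp.one_lt zero_ne_one
        (hm₁.symm.trans (h.trans hm₂))
    · rw [hq₁, hq₂]; exact hne.symm
    · intro h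
      exact hne ((hq₂.symm.trans (H.label_eq hb₁ hb₂ h).symm).trans hq₁)
  have hP := (mem_pLevels.mp hI).2
  have hc : (0 : ℤ) < p ^ ((pLevels p q r n A).filter (m + 1 ≤ ·)).card :=
    pow_pos (by exact_mod_cast hp.pos) _
  have hdich : ∀ x x', x ≡ x' [MOD p ^ m] →
      (∀ j k, wt p q r A (m + 1) x j k = wt p q r A (m + 1) x' j k) ∨
        (FlatRow p q r A (m + 1) x ∧ FlatRow p q r A (m + 1) x') := by
    intro x x' hx
    rcases hrow x with h | h
    · exact Or.inr ⟨h, FlatRow.of_adj H.hq hc hPQR hx h (hrow x')⟩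
    · rcases hrow x' with h' | h'
      · exact Or.inr ⟨FlatRow.of_adj H.hq hc hPQR hx.symm h' (hrow x), h'⟩
      · exact PointRow.dichotomy hp H.hq H.hr H.hpq H.hqr hPQR hP hx h h'
  refine ⟨⟨fun x => ?_, Or.inr ⟨c + 0 * p ^ e, fun k => by rw [hne2]; exact hcl' k 0 hp.pos⟩⟩, ?_⟩
  · by_cases hall : ∀ t < p, FlatRow p q r A (m + 1) (x + t * p ^ m)
    · exact Or.inl (FlatRow.merge hp.pos hall)
    · push Not at hall
      obtain ⟨t, ht, hnt⟩ := hall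
      have hrt := (hrow (x + t * p ^ m)).resolve_left hnt
      have hmul : ∀ j k, wt p q r A m x j k = p * wt p q r A (m + 1) (x + t * p ^ m) j k := by
        intro j k
        rw [wt_split hp.pos, Finset.sum_congr rfl fun s _ => ?_]
        · rw [Finset.sum_const, card_range, nsmul_eq_mul]
        · exact ((hdich (x + s * p ^ m) (x + t * p ^ m) ((add_mul_modEq p m x s).trans
            (add_mul_modEq p m x t).symm)).resolve_right fun h => hnt h.2) j k
      refine Or.inr ⟨fun j k => ?_, fun j l k h1 h2 => ?_⟩
      · rw [hmul, card_filter_ge, if_pos hI, pow_succ']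
        rcases hrt.1 j k with h | h
        · left; rw [h, mul_zero]
        · right; rw [h]
      · rw [hmul] at h1 h2
        exact hrt.2 j l k (right_ne_zero_of_mul h1) (right_ne_zero_of_mul h2)
  · intro x x' hx k
    rcases hdich x x' hx with h | h
    · exact Finset.sum_congr rfl fun j _ => h j k
    · exact FlatRow.sum_eq hP hx h.1 h.2 k

/-- One step of the descent at a level outside `pLevels`, in the presence of a full class of `B`. -/
lemma levelInv_step_notMem (H : CubePair p q r n A B) {m e c : ℕ} (hm : m + e + 1 = n)
    (hI : m ∉ pLevels p q r n A)
    (hrow : ∀ x, FlatRow p q r A (m + 1) x ∨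
      PointRow p q r A (m + 1) (p ^ ((pLevels p q r n A).filter (m + 1 ≤ ·)).card) x)
    (hcl : ∀ k : ZMod r, (B.filter fun b => b ≡ c [MOD p ^ e] ∧ (b : ZMod r) = k).card
      = p ^ ((pLevels p q r n A).filter (· < m + 1)).card) :
    LevelInv p q r n A B m := by
  have hp := H.hp
  have hne2 : n - m = e + 1 := by omega
  have hs : 0 < p ^ ((pLevels p q r n A).filter (· < m + 1)).card := pow_pos hp.pos _
  have hslice : ∀ b ∈ B, ∀ b' ∈ B, b ≡ c [MOD p ^ e] → b' ≡ c [MOD p ^ e] → (b : ZMod r) = b' →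
      b ≡ b' [MOD p ^ (e + 1)] := by
    intro b hb b' hb' h h' hr
    by_contra hd
    exact hI (mem_pLevels.mpr ⟨by omega, H.hAB.vanP b hb b' hb' e m (by omega) (h.trans h'.symm) hd
      (H.label_eq hb hb' hr) hr⟩)
  have hpt : ∀ k : ZMod r, ∃ b ∈ B, b ≡ c [MOD p ^ e] ∧ (b : ZMod r) = k := by
    intro k
    have h1 : 0 < (B.filter fun b => b ≡ c [MOD p ^ e] ∧ (b : ZMod r) = k).card := by
      rw [hcl k]; exact hs
    obtain ⟨b, hb⟩ := Finset.card_pos.mp h1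
    exact ⟨b, by simpa using hb⟩
  have hnotP : ¬ VanP p q r B e :=
    fun h => false_of_vanP_of_slices H.hp H.hr H.hpr e c _ hs hcl hslice h
  have hc : (0 : ℤ) < p ^ ((pLevels p q r n A).filter (m + 1 ≤ ·)).card :=
    pow_pos (by exact_mod_cast hp.pos) _
  by_cases hcom : ∀ b ∈ B, ∀ b' ∈ B, b ≡ c [MOD p ^ e] → b' ≡ c [MOD p ^ e] →
      b ≡ b' [MOD p ^ (e + 1)]
  · obtain ⟨b₀, hb₀, hm₀, -⟩ := hpt 0
    have hcl' : ∀ k : ZMod r, (B.filter fun b => b ≡ b₀ [MOD p ^ (e + 1)] ∧ (b : ZMod r) = k).card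
        = p ^ ((pLevels p q r n A).filter (· < m + 1)).card := by
      intro k
      rw [← hcl k]
      congr 1
      exact Finset.filter_congr fun b hb => ⟨fun h =>
        ⟨(h.1.of_dvd (pow_dvd_pow p (Nat.le_succ e))).trans hm₀, h.2⟩,
        fun h => ⟨hcom b hb b₀ hb₀ h.1 hm₀, h.2⟩⟩
    have hz : ∀ j k, wt p q r B (e + 1) (b₀ + 1 * p ^ e) j k = 0 := by
      intro j k
      by_contra hne
      obtain ⟨b, hb, h1, -, -⟩ := wt_ne_zero_iff.mp hne
      have h2 := hcom b hb b₀ hb₀ (((h1.of_dvd (pow_dvd_pow p (Nat.le_succ e))).trans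
        (add_mul_modEq p e b₀ 1)).trans hm₀) hm₀
      refine not_modEq_add_mul e b₀ hp.pos hp.one_lt zero_ne_one (((?_ : _ ≡ b [MOD _])).trans h1)
      simpa using h2.symm
    have hnotPQ : ¬ VanPQ p q r B e := by
      intro h
      have h1 : ∀ j, ∑ k, wt p q r B (e + 1) b₀ j k = ∑ k, wt p q r B (e + 1) b₀ 0 k := by
        intro j
        have := h b₀ (b₀ + 1 * p ^ e) (add_mul_modEq p e b₀ 1).symm j 0
        simp only [hz, Finset.sum_const_zero] at this
        linarith
      have h2 : ∑ j, ∑ k, wt p q r B (e + 1) b₀ j k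
          = r * p ^ ((pLevels p q r n A).filter (· < m + 1)).card := by
        rw [Finset.sum_comm]
        simp only [sum_wt_left, hcl']
        simp [ZMod.card]
      rw [Finset.sum_congr rfl fun j _ => h1 j] at h2
      simp only [Finset.sum_const, Finset.card_univ, ZMod.card, nsmul_eq_mul] at h2
      have h5 : (q : ℤ) ∣ (r * p ^ ((pLevels p q r n A).filter (· < m + 1)).card : ℕ) :=
        ⟨_, by push_cast; exact h2.symm⟩
      rcases H.hq.dvd_mul.mp (by exact_mod_cast h5) with h6 | h6
      · exact H.hqr ((Nat.prime_dvd_prime_iff_eq H.hq H.hr).mp h6)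
      · exact H.hpq ((Nat.prime_dvd_prime_iff_eq H.hq hp).mp (H.hq.dvd_of_dvd_pow h6)).symm
    have hns : ∀ y y', y ≡ y' [MOD p ^ m] → ¬ y ≡ y' [MOD p ^ (m + 1)] → ∀ j l k,
        wt p q r A (m + 1) y j k ≠ 0 → wt p q r A (m + 1) y' l k ≠ 0 → False := by
      intro y y' hy hny j l k h1 h2
      obtain ⟨a₁, ha₁, m₁, q₁, r₁⟩ := wt_ne_zero_iff.mp h1
      obtain ⟨a₂, ha₂, m₂, q₂, r₂⟩ := wt_ne_zero_iff.mp h2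
      have hd := pow_dvd_pow p (Nat.le_succ m)
      have e1 : a₁ ≡ a₂ [MOD p ^ m] := (m₁.of_dvd hd).trans (hy.trans (m₂.of_dvd hd).symm)
      have e2 : ¬ a₁ ≡ a₂ [MOD p ^ (m + 1)] := fun h => hny (m₁.symm.trans (h.trans m₂))
      have e3 := r₁.trans r₂.symm
      by_cases hq : (a₁ : ZMod q) = a₂
      · exact hnotP (H.hBA.vanP a₁ ha₁ a₂ ha₂ m e hm e1 e2 hq e3)
      · exact hnotPQ (H.hBA.vanPQ a₁ ha₁ a₂ ha₂ m e hm e1 e2 hq e3)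
    refine ⟨fun x => ?_, Or.inr ⟨b₀, fun k => ?_⟩⟩
    · by_cases hall : ∀ t < p, FlatRow p q r A (m + 1) (x + t * p ^ m)
      · exact Or.inl (FlatRow.merge hp.pos hall)
      · push Not at hall
        obtain ⟨t, ht, hnt⟩ := hall
        have hns' : ∀ s < p, ∀ s' < p, ∀ j l k, wt p q r A (m + 1) (x + s * p ^ m) j k ≠ 0 →
            wt p q r A (m + 1) (x + s' * p ^ m) l k ≠ 0 → s = s' := by
          intro s hs s' hs' j l k h1 h2
          by_contra hne
          exact hns _ _ ((add_mul_modEq p m x s).trans (add_mul_modEq p m x s').symm)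
            (not_modEq_add_mul m x hs hs' hne) j l k h1 h2
        have hpoint : ∀ s < p, PointRow p q r A (m + 1)
            (p ^ ((pLevels p q r n A).filter (m + 1 ≤ ·)).card) (x + s * p ^ m) := by
          intro s hs
          rcases hrow (x + s * p ^ m) with h | h
          · have hst : s ≠ t := by rintro rfl; exact hnt h
            have hz : ∀ j k, wt p q r A (m + 1) (x + s * p ^ m) j k = 0 := by
              intro j k
              by_contra hne
              have : ∃ j' k', wt p q r A (m + 1) (x + t * p ^ m) j' k' ≠ 0 := by
                by_contra! h0
                exact hnt fun j k k' => by rw [h0, h0]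
              obtain ⟨j', k', hne'⟩ := this
              exact hst (hns' s hs t ht j j' k' (by rw [h j k' k]; exact hne) hne')
            exact ⟨fun j k => Or.inl (hz j k), fun j l k h1 => absurd (hz j k) h1⟩
          · exact h
        have hex : ∀ j k, wt p q r A m x j k ≠ 0 → ∃ s < p,
            wt p q r A (m + 1) (x + s * p ^ m) j k ≠ 0 := by
          intro j k h
          rw [wt_split hp.pos] at h
          obtain ⟨s, hs, h'⟩ := Finset.exists_ne_zero_of_sum_ne_zero h
          exact ⟨s, mem_range.mp hs, h'⟩
        refine Or.inr ⟨fun j k => ?_, fun j l k h1 h2 => ?_⟩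
        · by_cases h0 : wt p q r A m x j k = 0
          · exact Or.inl h0
          · right
            obtain ⟨s, hs, h'⟩ := hex j k h0
            rw [card_filter_ge, if_neg hI, add_zero, wt_split hp.pos,
              Finset.sum_eq_single_of_mem s (mem_range.mpr hs)]
            · exact ((hpoint s hs).1 j k).resolve_left h'
            · intro s' hs' hne
              by_contra h''
              exact hne (hns' s' (mem_range.mp hs') s hs j j k h'' h')
        · obtain ⟨s, hs, h1'⟩ := hex j k h1
          obtain ⟨s', hs', h2'⟩ := hex l k h2
          obtain rfl := hns' s hs s' hs' j l k h1' h2'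
          exact (hpoint s hs).2 j l k h1' h2'
    · rw [hne2, hcl' k, card_filter_lt_succ, if_neg hI, add_zero]
  · push Not at hcom
    obtain ⟨b, hb, b', hb', hbc, hbc', hd⟩ := hcom
    have hPQR : VanPQR p q r A m := by
      have mk : ∀ x ∈ B, ∀ y ∈ B, x ≡ c [MOD p ^ e] → y ≡ c [MOD p ^ e] →
          ¬ x ≡ y [MOD p ^ (e + 1)] → (x : ZMod q) ≠ y → VanPQR p q r A m := by
        intro x hx y hy h1 h2 h3 h4
        exact H.hAB.vanPQR x hx y hy e m (by omega) (h1.trans h2.symm) h3 h4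
          fun h => h4 (H.label_eq hx hy h)
      by_cases hq : (b : ZMod q) = b'
      · obtain ⟨z, hz, hzq⟩ := H.exists_label_ne b
        obtain ⟨y, hy, hyc, hyr⟩ := hpt z
        have hyq : (y : ZMod q) ≠ b := by rw [H.label_eq hy hz hyr]; exact hzq
        by_cases hyb : y ≡ b [MOD p ^ (e + 1)]
        · exact mk y hy b' hb' hyc hbc' (fun h => hd (hyb.symm.trans h)) (hq ▸ hyq)
        · exact mk y hy b hb hyc hbc hyb hyq
      · exact mk b hb b' hb' hbc hbc' hd hq
    have hflat : ∀ x, FlatRow p q r A (m + 1) x := by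
      intro x
      by_contra hnx
      have hrow' : ∀ y, y ≡ x [MOD p ^ m] → PointRow p q r A (m + 1)
          (p ^ ((pLevels p q r n A).filter (m + 1 ≤ ·)).card) y := by
        intro y hy
        refine (hrow y).resolve_left fun h => hnx ?_
        exact FlatRow.of_adj H.hq hc hPQR hy h (hrow x)
      have hx := (hrow' x rfl).1
      have : ∃ j k k', wt p q r A (m + 1) x j k
          = p ^ ((pLevels p q r n A).filter (m + 1 ≤ ·)).card ∧ wt p q r A (m + 1) x j k' = 0 := by
        by_contra! h0
        refine hnx fun j k k' => ?_
        have a1 := h0 j k k'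
        have a2 := h0 j k' k
        rcases hx j k with h1 | h1 <;> rcases hx j k' with h2 | h2
        · rw [h1, h2]
        · exact absurd h1 (a2 h2)
        · exact absurd h2 (a1 h1)
        · rw [h1, h2]
      obtain ⟨j, k, k', h1, h2⟩ := this
      exact hnotP (H.hBA.vanP_of_not_const hp H.hq H.hpq hm _ hc x
        (fun y hy => (hrow' y hy).1) (fun y hy => (hrow' y hy).2) hPQR j k k' h1 h2)
    have : ∀ x, FlatRow p q r A m x := fun x => FlatRow.merge hp.pos fun t _ => hflat _
    exact ⟨fun x => Or.inl (this x), Or.inl this⟩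

lemma levelInv_step (H : CubePair p q r n A B) {m : ℕ} (hm : m < n)
    (h : LevelInv p q r n A B (m + 1)) :
    LevelInv p q r n A B m ∧ (m ∈ pLevels p q r n A → SliceVan p q r A m) := by
  obtain ⟨hrow, hflat | ⟨c, hcl⟩⟩ := h
  · have : ∀ x, FlatRow p q r A m x := fun x => FlatRow.merge H.hp.pos fun t _ => hflat _
    exact ⟨⟨fun x => Or.inl (this x), Or.inl this⟩,
      fun hI x x' hx k => FlatRow.sum_eq (mem_pLevels.mp hI).2 hx (hflat x) (hflat x') k⟩
  · have hme : m + (n - (m + 1)) + 1 = n := by omega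
    by_cases hI : m ∈ pLevels p q r n A
    · have := H.levelInv_step_mem hme hI hrow hcl
      exact ⟨this.1, fun _ => this.2⟩
    · exact ⟨H.levelInv_step_notMem hme hI hrow hcl, fun h => absurd h hI⟩

lemma levelInv (H : CubePair p q r n A B) (m : ℕ) (hm : m ≤ n) :
    LevelInv p q r n A B (n - m) := by
  induction m with
  | zero => exact H.levelInv_top
  | succ m ih =>
    have := ih (by omega)
    rw [show n - m = n - (m + 1) + 1 by omega] at this
    exact (H.levelInv_step (by omega) this).1

lemma sliceVan (H : CubePair p q r n A B) {m : ℕ} (hm : m ∈ pLevels p q r n A) :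
    SliceVan p q r A m := by
  have hmn := (mem_pLevels.mp hm).1
  have := H.levelInv (n - (m + 1)) (by omega)
  rw [show n - (n - (m + 1)) = m + 1 by omega] at this
  exact (H.levelInv_step hmn this).2 hm

lemma card_slice_left (H : CubePair p q r n A B) (k : ZMod r) :
    ∑ j, wt p q r A 0 0 j k = p ^ (pLevels p q r n A).card := by
  have htot : ∑ k, ∑ j, wt p q r A 0 0 j k = r * p ^ (pLevels p q r n A).card := by
    rw [Finset.sum_comm, sum_sum_wt]
    have hB : B.card = r * p ^ (pLevels p q r n A).card := by
      rw [Finset.card_eq_sum_card_fiberwise (f := fun a : ℕ => (a : ZMod r)) (t := univ) (by simp)]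
      simp only [H.card_slice]
      simp [ZMod.card]
    simp [Nat.modEq_one, H.card_eq, hB]
  have h := H.levelInv n le_rfl
  rw [Nat.sub_self] at h
  rcases h.1 0 with h | h
  · rw [Finset.sum_congr rfl fun k' _ => Finset.sum_congr rfl fun j _ => h j k' k] at htot
    simp only [Finset.sum_const, Finset.card_univ, ZMod.card, nsmul_eq_mul] at htot
    exact mul_left_cancel₀ (by exact_mod_cast NeZero.ne r) htot
  · rw [Finset.filter_true_of_mem fun i _ => Nat.zero_le i] at h
    have hle : ∀ k ∈ (univ : Finset (ZMod r)), ∑ j, wt p q r A 0 0 j k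
        ≤ p ^ (pLevels p q r n A).card := by
      intro k _
      by_cases h0 : ∃ j, wt p q r A 0 0 j k ≠ 0
      · obtain ⟨j, hj⟩ := h0
        rw [Finset.sum_eq_single j]
        · exact ((h.1 j k).resolve_left hj).le
        · intro l _ hl
          by_contra hne
          exact hl (h.2 l j k hne hj)
        · simp
      · push Not at h0
        rw [Finset.sum_eq_zero fun j _ => h0 j]
        positivity
    exact (Finset.sum_eq_sum_iff_of_le hle).mp (by rw [htot]; simp [ZMod.card]) k (mem_univ k)

end CubePair

end

lemma card_class_eq {p n : ℕ} (hp : 0 < p) (I : Finset ℕ) (hI : ∀ i ∈ I, i < n) (S : Finset ℕ)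
    (hcard : S.card = p ^ I.card)
    (heq : ∀ i ∈ I, ∀ x x', x ≡ x' [MOD p ^ i] → (S.filter (· ≡ x [MOD p ^ (i + 1)])).card
      = (S.filter (· ≡ x' [MOD p ^ (i + 1)])).card) (a : ℕ) (ha : a ∈ S) (i : ℕ) (hi : i ≤ n) :
    (S.filter (· ≡ a [MOD p ^ i])).card = p ^ (I.filter (i ≤ ·)).card := by
  have hsub : ∀ i, (S.filter (· ≡ a [MOD p ^ (i + 1)])).card ≤ (S.filter (· ≡ a [MOD p ^ i])).card :=
    fun i => Finset.card_le_card (Finset.monotone_filter_right S fun x _ h =>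
      Nat.ModEq.of_dvd (pow_dvd_pow p (Nat.le_succ i)) h)
  have hmul : ∀ i ∈ I, (S.filter (· ≡ a [MOD p ^ i])).card
      = p * (S.filter (· ≡ a [MOD p ^ (i + 1)])).card := by
    intro i hi
    rw [card_filter_modEq_split hp, Finset.sum_congr rfl fun t _ =>
      heq i hi (a + t * p ^ i) a (by simp [Nat.ModEq])]
    rw [Finset.sum_const, card_range, smul_eq_mul]
  refine le_antisymm ?_ ?_
  · clear hi
    induction i with
    | zero => simp [Nat.modEq_one, hcard]
    | succ i ih =>
      rw [card_filter_ge] at ih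
      split_ifs at ih with h
      · rw [hmul i h, pow_succ' p (card _)] at ih
        exact Nat.le_of_mul_le_mul_left ih hp
      · exact (hsub i).trans ih
  · have key : ∀ m, m ≤ n → p ^ (I.filter (n - m ≤ ·)).card
        ≤ (S.filter (· ≡ a [MOD p ^ (n - m)])).card := by
      intro m
      induction m with
      | zero =>
        intro _
        rw [Finset.filter_false_of_mem fun i h => by have := hI i h; omega, card_empty, pow_zero]
        exact Finset.card_pos.mpr ⟨a, by simp [ha, Nat.ModEq.refl]⟩
      | succ m ih =>
        intro hm
        have ih := ih (by omega)
        rw [show n - m = n - (m + 1) + 1 by omega] at ih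
        rw [card_filter_ge]
        split_ifs with h
        · rw [hmul _ h, pow_succ']
          exact Nat.mul_le_mul_left p ih
        · exact ih.trans (hsub _)
    have := key (n - i) (by omega)
    rwa [show n - (n - i) = i by omega] at this

lemma val_modEq_iff {N d : ℕ} [NeZero N] (h : d ∣ N) (x y : ZMod N) :
    x.val ≡ y.val [MOD d] ↔ ZMod.castHom h (ZMod d) x = ZMod.castHom h (ZMod d) y := by
  rw [← ZMod.natCast_eq_natCast_iff, ZMod.natCast_val, ZMod.natCast_val]
  rfl

lemma mod_pow_eq_of_lt {p i s t : ℕ} (hs : s % p ^ (i + 1) < p ^ i)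
    (ht : t % p ^ (i + 1) < p ^ i) (h : s ≡ t [MOD p ^ i]) : s ≡ t [MOD p ^ (i + 1)] := by
  have e : ∀ u, u % p ^ (i + 1) < p ^ i → u % p ^ (i + 1) = u % p ^ i := fun u hu => by
    rw [← Nat.mod_mod_of_dvd u (pow_dvd_pow p (Nat.le_succ i)), Nat.mod_eq_of_lt hu]
  rw [Nat.ModEq, e s hs, e t ht]
  exact h

/-- A set whose slices modulo `r` are equidistributed at a full set of digits tiles. -/
lemma tiles_of_slices {p q r n N : ℕ} [NeZero N] (hp : 0 < p) (hN : N = p ^ n * q * r)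
    (A : Finset (ZMod N)) (I : Finset ℕ) (hI : ∀ i ∈ I, i < n)
    (hcard : ∀ k : ZMod r, ((A.image ZMod.val).filter fun a : ℕ => (a : ZMod r) = k).card
      = p ^ I.card)
    (heq : ∀ i ∈ I, ∀ x x', x ≡ x' [MOD p ^ i] → ∀ k : ZMod r,
      ((A.image ZMod.val).filter fun a => a ≡ x [MOD p ^ (i + 1)] ∧ (a : ZMod r) = k).card
      = ((A.image ZMod.val).filter fun a => a ≡ x' [MOD p ^ (i + 1)] ∧ (a : ZMod r) = k).card) :
    Tiles N A := by
  classical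
  have hdp : ∀ i, i ≤ n → p ^ i ∣ N := fun i hi => by
    rw [hN, mul_assoc]; exact (pow_dvd_pow p hi).mul_right _
  have hdr : r ∣ N := ⟨p ^ n * q, by rw [hN]; ring⟩
  set ρ := ZMod.castHom hdr (ZMod r) with hρ
  have hρv : ∀ x : ZMod N, (x.val : ZMod r) = ρ x := fun x => ZMod.natCast_val x
  set S : ZMod r → Finset ℕ := fun k => (A.image ZMod.val).filter fun a : ℕ => (a : ZMod r) = k
    with hS
  have hmemS : ∀ a ∈ A, a.val ∈ S (ρ a) := fun a ha => by
    rw [hS, mem_filter]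
    exact ⟨mem_image_of_mem _ ha, hρv a⟩
  have hfilt : ∀ (k : ZMod r) (P : ℕ → Prop) [DecidablePred P], (S k).filter P
      = (A.image ZMod.val).filter fun a => P a ∧ (a : ZMod r) = k := by
    intro k P _
    rw [hS, Finset.filter_filter]
    exact Finset.filter_congr fun a _ => and_comm
  have heqS : ∀ k, ∀ i ∈ I, ∀ x x', x ≡ x' [MOD p ^ i] →
      ((S k).filter (· ≡ x [MOD p ^ (i + 1)])).card
        = ((S k).filter (· ≡ x' [MOD p ^ (i + 1)])).card := by
    intro k i hi x x' hx
    rw [hfilt, hfilt]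
    exact heq i hi x x' hx k
  have hclass := fun k => card_class_eq hp I hI (S k) (hcard k) (heqS k)
  refine ⟨univ.filter fun t => ρ t = 0 ∧ ∀ i ∈ I, t.val % p ^ (i + 1) < p ^ i, fun g => ?_⟩
  have hex : ∀ m, m ≤ n → ∃ a ∈ A, ρ a = ρ g ∧
      ∀ i ∈ I, i < m → (g - a).val % p ^ (i + 1) < p ^ i := by
    intro m
    induction m with
    | zero =>
      intro _
      have h1 : 0 < (S (ρ g)).card := by rw [hcard]; exact pow_pos hp _
      obtain ⟨a', ha'⟩ := Finset.card_pos.mp h1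
      rw [hS, mem_filter, mem_image] at ha'
      obtain ⟨⟨a, ha, rfl⟩, h2⟩ := ha'
      exact ⟨a, ha, by rw [← hρv, h2], by simp⟩
    | succ m ih =>
      intro hm
      obtain ⟨a, ha, har, hdig⟩ := ih (by omega)
      by_cases hmI : m ∈ I
      · set u := (g - a).val % p ^ m with hu
        have hpm : 0 < p ^ m := pow_pos hp m
        set y : ZMod N := g - (u : ZMod N) with hy
        have hcu : ZMod.castHom (hdp m (by omega)) (ZMod (p ^ m)) (u : ZMod N)
            = ZMod.castHom (hdp m (by omega)) (ZMod (p ^ m)) (g - a) := by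
          rw [map_natCast, hu, ZMod.natCast_mod, ZMod.natCast_val]
          rfl
        have hya : y.val ≡ a.val [MOD p ^ m] := by
          rw [val_modEq_iff (hdp m (by omega)), hy, map_sub, hcu, map_sub, sub_sub_cancel]
        have h1 : 0 < ((S (ρ g)).filter (· ≡ y.val [MOD p ^ (m + 1)])).card := by
          rw [heqS _ m hmI y.val a.val hya]
          exact Finset.card_pos.mpr ⟨a.val, by
            rw [mem_filter, ← har]; exact ⟨hmemS a ha, rfl⟩⟩
        obtain ⟨b', hb'⟩ := Finset.card_pos.mp h1
        rw [mem_filter, hS, mem_filter, mem_image] at hb'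
        obtain ⟨⟨⟨b, hb, rfl⟩, h2⟩, h3⟩ := hb'
        have hba : b.val ≡ a.val [MOD p ^ m] := (h3.of_dvd (pow_dvd_pow p (Nat.le_succ m))).trans hya
        refine ⟨b, hb, by rw [← hρv, h2], fun i hi him => ?_⟩
        rcases Nat.lt_succ_iff_lt_or_eq.mp him with h4 | rfl
        · have h5 : (g - b).val ≡ (g - a).val [MOD p ^ (i + 1)] := by
            have h6 := hba.of_dvd (pow_dvd_pow p (show i + 1 ≤ m by omega))
            rw [val_modEq_iff (hdp (i + 1) (by omega))] at h6 ⊢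
            rw [map_sub, map_sub, h6]
          rw [h5]
          exact hdig i hi h4
        · have h5 : (g - b).val ≡ u [MOD p ^ (i + 1)] := by
            rw [val_modEq_iff (hdp (i + 1) hm)] at h3
            rw [← ZMod.natCast_eq_natCast_iff, ZMod.natCast_val]
            have : (g - b).cast = ZMod.castHom (hdp (i + 1) hm) (ZMod (p ^ (i + 1))) (g - b) := rfl
            rw [this, map_sub, h3, hy, map_sub, map_natCast, sub_sub_cancel]
          rw [h5]
          have h7 : u < p ^ i := Nat.mod_lt _ hpm
          exact (Nat.mod_le _ _).trans_lt h7
      · exact ⟨a, ha, har, fun i hi him => hdig i hi (by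
          rcases Nat.lt_succ_iff_lt_or_eq.mp him with h | rfl
          · exact h
          · exact absurd hi hmI)⟩
  obtain ⟨a, ha, har, hdig⟩ := hex n le_rfl
  refine ⟨(a, g - a), ⟨ha, ?_, by simp⟩, ?_⟩
  · simp only [mem_filter, mem_univ, true_and]
    exact ⟨by rw [map_sub, har, sub_self], fun i hi => hdig i hi (hI i hi)⟩
  · rintro ⟨b, t⟩ ⟨hb, ht, hg⟩
    simp only [mem_filter, mem_univ, true_and] at hb ht hg
    have hbr : ρ b = ρ g := by rw [← hg, map_add, ht.1, add_zero]
    have hat : a + (g - a) = b + t := by rw [hg]; ring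
    have hmod : ∀ i, i ≤ n → b.val ≡ a.val [MOD p ^ i] := by
      intro i
      induction i with
      | zero => intro _; simp [Nat.modEq_one]
      | succ i ih =>
        intro hi
        have ih := ih (by omega)
        by_cases hiI : i ∈ I
        · have h1 : t.val ≡ (g - a).val [MOD p ^ i] := by
            rw [val_modEq_iff (hdp i (by omega))] at ih ⊢
            rw [map_sub, ← hg, map_add, ih, add_sub_cancel_left]
          have h2 := mod_pow_eq_of_lt (ht.2 i hiI) (hdig i hiI (hI i hiI)) h1
          rw [val_modEq_iff (hdp (i + 1) hi)] at h2 ⊢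
          have h3 := congrArg (ZMod.castHom (hdp (i + 1) hi) (ZMod (p ^ (i + 1)))) hat
          rw [map_add, map_add, h2] at h3
          exact (add_right_cancel h3).symm
        · have h1 := hclass (ρ g) a.val (har ▸ hmemS a ha) i (by omega)
          have h2 := hclass (ρ g) a.val (har ▸ hmemS a ha) (i + 1) hi
          rw [card_filter_ge, if_neg hiI, add_zero, ← h2] at h1
          have h3 := Finset.eq_of_subset_of_card_le
            (Finset.monotone_filter_right (S (ρ g)) fun x _ h =>
              Nat.ModEq.of_dvd (pow_dvd_pow p (Nat.le_succ i)) h) h1.le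
          have h4 : b.val ∈ (S (ρ g)).filter (· ≡ a.val [MOD p ^ i]) := by
            rw [mem_filter]; exact ⟨hbr ▸ hmemS b hb, ih⟩
          rw [← h3] at h4
          exact (mem_filter.mp h4).2
    have h1 := hclass (ρ g) a.val (har ▸ hmemS a ha) n le_rfl
    rw [Finset.filter_false_of_mem (s := I) fun i h => by have := hI i h; omega, card_empty,
      pow_zero] at h1
    have h2 : b.val = a.val := Finset.card_le_one.mp h1.le _
      (by rw [mem_filter]; exact ⟨hbr ▸ hmemS b hb, hmod n le_rfl⟩) _
      (by rw [mem_filter]; exact ⟨har ▸ hmemS a ha, rfl⟩)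
    have h3 := ZMod.val_injective N h2
    subst h3
    rw [Prod.mk.injEq]
    exact ⟨rfl, by rw [← hg]; ring⟩

/-- The span of the sequences `a ↦ μ ^ a`, for `μ` a primitive `d`-th root of unity. -/
def rootSpan (d : ℕ) : Submodule ℂ (ℕ → ℂ) :=
  Submodule.span ℂ {f | ∃ μ : ℂ, IsPrimitiveRoot μ d ∧ f = fun a => μ ^ a}

lemma mul_mem_rootSpan {d e : ℕ} (h : d.Coprime e) {f g : ℕ → ℂ} (hf : f ∈ rootSpan d)
    (hg : g ∈ rootSpan e) : f * g ∈ rootSpan (d * e) := by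
  have := Submodule.mul_mem_mul hf hg
  rw [rootSpan, rootSpan, Submodule.span_mul_span] at this
  refine Submodule.span_mono ?_ this
  rintro _ ⟨_, ⟨μ, hμ, rfl⟩, _, ⟨ν, hν, rfl⟩, rfl⟩
  refine ⟨μ * ν, ?_, ?_⟩
  · rw [hμ.eq_orderOf, hν.eq_orderOf] at h ⊢
    rw [← (Commute.all μ ν).orderOf_mul_eq_mul_orderOf_of_coprime h]
    exact IsPrimitiveRoot.orderOf _
  · ext a
    simp [mul_pow]

lemma sum_pow_mul_inv {M : ℕ} (hM : 0 < M) {ζ : ℂ} (hζ : IsPrimitiveRoot ζ M) (a x : ℕ) :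
    ∑ t ∈ range M, ((ζ ^ t) ^ x)⁻¹ * (ζ ^ t) ^ a = if a ≡ x [MOD M] then (M : ℂ) else 0 := by
  have h0 : ζ ≠ 0 := hζ.ne_zero hM.ne'
  have h1 : ∀ t, ((ζ ^ t) ^ x)⁻¹ * (ζ ^ t) ^ a = (ζ ^ ((a : ℤ) - x)) ^ t := fun t => by
    rw [zpow_sub₀ h0, zpow_natCast, zpow_natCast, div_pow, ← pow_mul, ← pow_mul, ← pow_mul,
      ← pow_mul, mul_comm t x, mul_comm t a, div_eq_mul_inv, mul_comm]
  simp only [h1]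
  have h2 : ζ ^ ((a : ℤ) - x) = 1 ↔ a ≡ x [MOD M] := by
    rw [hζ.zpow_eq_one_iff_dvd, ← Int.natCast_modEq_iff, Int.modEq_comm, Int.modEq_iff_dvd]
  split_ifs with h
  · simp [h2.mpr h]
  · have h3 : (ζ ^ ((a : ℤ) - x)) ^ M = 1 := by
      rw [← zpow_natCast, ← zpow_mul, mul_comm, zpow_mul, zpow_natCast, hζ.pow_eq_one, one_zpow]
    rw [geom_sum_eq fun h4 => h (h2.mp h4), h3, sub_self, zero_div]

lemma sub_indicator_mem_rootSpan {l : ℕ} (hl : l.Prime) (i : ℕ) {x y : ℕ}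
    (hxy : x ≡ y [MOD l ^ i]) :
    (fun a : ℕ => (if a ≡ x [MOD l ^ (i + 1)] then (1 : ℂ) else 0)
      - if a ≡ y [MOD l ^ (i + 1)] then 1 else 0) ∈ rootSpan (l ^ (i + 1)) := by
  have hM : 0 < l ^ (i + 1) := pow_pos hl.pos _
  have hMC : ((l ^ (i + 1) : ℕ) : ℂ) ≠ 0 := by exact_mod_cast hM.ne'
  obtain ⟨ζ, hζ⟩ : ∃ ζ : ℂ, IsPrimitiveRoot ζ (l ^ (i + 1)) :=
    ⟨_, Complex.isPrimitiveRoot_exp _ hM.ne'⟩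
  have hsum : ∀ a : ℕ, (if a ≡ x [MOD l ^ (i + 1)] then (1 : ℂ) else 0)
      - (if a ≡ y [MOD l ^ (i + 1)] then 1 else 0)
      = ((l ^ (i + 1) : ℕ) : ℂ)⁻¹ * ∑ t ∈ range (l ^ (i + 1)),
        (((ζ ^ t) ^ x)⁻¹ - ((ζ ^ t) ^ y)⁻¹) * (ζ ^ t) ^ a := by
    intro a
    simp only [sub_mul, Finset.sum_sub_distrib]
    rw [sum_pow_mul_inv hM hζ, sum_pow_mul_inv hM hζ]
    split_ifs <;> simp only [mul_zero, sub_zero, zero_sub, sub_self, mul_neg, inv_mul_cancel₀ hMC]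
  have hfun : (fun a : ℕ => (if a ≡ x [MOD l ^ (i + 1)] then (1 : ℂ) else 0)
      - if a ≡ y [MOD l ^ (i + 1)] then 1 else 0)
      = ((l ^ (i + 1) : ℕ) : ℂ)⁻¹ • ∑ t ∈ range (l ^ (i + 1)),
        (((ζ ^ t) ^ x)⁻¹ - ((ζ ^ t) ^ y)⁻¹) • fun a : ℕ => (ζ ^ t) ^ a := by
    ext a
    rw [hsum]
    simp [Finset.sum_apply]
  rw [hfun]
  refine Submodule.smul_mem _ _ (Submodule.sum_mem _ fun t _ => ?_)
  by_cases ht : t.Coprime (l ^ (i + 1))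
  · exact Submodule.smul_mem _ _ (Submodule.subset_span ⟨_, hζ.pow_of_coprime t ht, rfl⟩)
  · have h1 : l ∣ t := by
      by_contra h
      exact ht ((Nat.Coprime.pow_left _ ((Nat.Prime.coprime_iff_not_dvd hl).mpr h)).symm)
    obtain ⟨s, rfl⟩ := h1
    have h2 : (ζ ^ (l * s)) ^ (l ^ i) = 1 := by
      rw [← pow_mul, show l * s * l ^ i = l ^ (i + 1) * s by ring, pow_mul, hζ.pow_eq_one,
        one_pow]
    have h3 : (ζ ^ (l * s)) ^ x = (ζ ^ (l * s)) ^ y := by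
      rw [pow_eq_pow_mod x h2, pow_eq_pow_mod y h2, hxy]
    rw [h3, sub_self, zero_smul]
    exact Submodule.zero_mem _

lemma sub_indicator_cast_mem_rootSpan {l : ℕ} [NeZero l] (hl : l.Prime) (j k : ZMod l) :
    (fun a : ℕ => (if (a : ZMod l) = j then (1 : ℂ) else 0)
      - if (a : ZMod l) = k then 1 else 0) ∈ rootSpan l := by
  have h := sub_indicator_mem_rootSpan hl 0 (x := j.val) (y := k.val) (by simp [Nat.modEq_one])
  have h1 : ∀ (a : ℕ) (j : ZMod l), (a : ZMod l) = j ↔ a ≡ j.val [MOD l ^ (0 + 1)] := by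
    intro a j
    rw [zero_add, pow_one, ← ZMod.natCast_eq_natCast_iff, ZMod.natCast_val, ZMod.cast_id]
  simp only [← h1] at h
  rwa [zero_add, pow_one] at h

lemma sum_pow_eq_zero_of_isPrimitiveRoot {d : ℕ} (hd : 0 < d) {μ ν : ℂ} (hμ : IsPrimitiveRoot μ d)
    (hν : IsPrimitiveRoot ν d) (A : Finset ℕ) (h : ∑ a ∈ A, μ ^ a = 0) : ∑ a ∈ A, ν ^ a = 0 := by
  set P : Polynomial ℚ := ∑ a ∈ A, Polynomial.X ^ a with hP
  have h1 : minpoly ℚ μ ∣ P := minpoly.dvd ℚ μ (by simp [hP, h])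
  rw [← Polynomial.cyclotomic_eq_minpoly_rat hμ hd, Polynomial.cyclotomic_eq_minpoly_rat hν hd]
    at h1
  obtain ⟨Q, hQ⟩ := h1
  have h2 : Polynomial.aeval ν P = 0 := by rw [hQ, map_mul, minpoly.aeval, zero_mul]
  simpa [hP] using h2

section

variable {N : ℕ} [NeZero N]

lemma chi_eq_sum_stdAddChar (A : Finset (ZMod N)) (b : ZMod N) :
    chi N A b = ∑ a ∈ A, ZMod.stdAddChar (a * b) := by
  refine Finset.sum_congr rfl fun a _ => ?_
  rw [ZMod.stdAddChar_apply, ZMod.toCircle_apply]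

lemma chi_eq_sum_pow (A : Finset (ZMod N)) (b : ZMod N) :
    chi N A b = ∑ a ∈ A.image ZMod.val, (ZMod.stdAddChar b : ℂ) ^ a := by
  rw [chi_eq_sum_stdAddChar, Finset.sum_image fun x _ y _ h => ZMod.val_injective N h]
  refine Finset.sum_congr rfl fun a _ => ?_
  rw [← AddChar.map_nsmul_eq_pow, nsmul_eq_mul, ZMod.natCast_zmod_val]

lemma isPrimitiveRoot_stdAddChar {d : ℕ} (b : ZMod N) (h : N.gcd b.val * d = N) :
    IsPrimitiveRoot (ZMod.stdAddChar b : ℂ) d := by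
  have hN := NeZero.pos N
  have hd : addOrderOf b = d := by
    conv_lhs => rw [← ZMod.natCast_zmod_val b, ZMod.addOrderOf_coe _ (NeZero.ne N)]
    have h1 : 0 < N.gcd b.val := Nat.gcd_pos_of_pos_left _ hN
    exact Nat.div_eq_of_eq_mul_right h1 h.symm
  rw [← hd]
  refine ⟨?_, fun m hm => ?_⟩
  · rw [← AddChar.map_nsmul_eq_pow, addOrderOf_nsmul_eq_zero, AddChar.map_zero_eq_one]
  · rw [← AddChar.map_nsmul_eq_pow] at hm
    rw [addOrderOf_dvd_iff_nsmul_eq_zero]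
    apply ZMod.injective_stdAddChar
    rw [hm, AddChar.map_zero_eq_one]

lemma sum_eq_zero_of_chi_eq_zero {d : ℕ} {A : Finset (ZMod N)} {b : ZMod N}
    (hb : chi N A b = 0) (h : N.gcd b.val * d = N) {f : ℕ → ℂ} (hf : f ∈ rootSpan d) :
    ∑ a ∈ A.image ZMod.val, f a = 0 := by
  have hd : 0 < d := Nat.pos_of_ne_zero fun h0 => NeZero.ne N (by rw [← h, h0, mul_zero])
  rw [chi_eq_sum_pow] at hb
  induction hf using Submodule.span_induction with
  | mem f hf =>
    obtain ⟨μ, hμ, rfl⟩ := hf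
    exact sum_pow_eq_zero_of_isPrimitiveRoot hd (isPrimitiveRoot_stdAddChar b h) hμ _ hb
  | zero => simp
  | add f g _ _ hf hg => simp [Finset.sum_add_distrib, hf, hg]
  | smul c f _ hf => simp [← Finset.mul_sum, hf]

lemma chi_eq_zero_of_gcd_eq {A : Finset (ZMod N)} {b c : ZMod N} (hb : chi N A b = 0)
    (h : N.gcd b.val = N.gcd c.val) : chi N A c = 0 := by
  obtain ⟨d, hd⟩ := Nat.gcd_dvd_left N b.val
  rw [chi_eq_sum_pow]
  exact sum_eq_zero_of_chi_eq_zero hb hd.symm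
    (Submodule.subset_span ⟨_, isPrimitiveRoot_stdAddChar c (h ▸ hd.symm), rfl⟩)

/-- Spectral pairs are symmetric. -/
lemma IsSpectralPair.symm {A B : Finset (ZMod N)} (h : IsSpectralPair N A B) :
    IsSpectralPair N B A := by
  refine ⟨h.1.symm, fun a ha a' ha' haa => ?_⟩
  have hA : (A.card : ℂ) ≠ 0 := by exact_mod_cast (Finset.card_pos.mpr ⟨a, ha⟩).ne'
  set U : Matrix B A ℂ := fun b a => (A.card : ℂ)⁻¹ * ZMod.stdAddChar (-(a.1 * b.1)) with hU
  set V : Matrix A B ℂ := fun a b => ZMod.stdAddChar (a.1 * b.1) with hV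
  have h1 : U * V = 1 := by
    ext b b'
    have h2 : (U * V) b b' = (A.card : ℂ)⁻¹ * chi N A (b'.1 - b.1) := by
      rw [Matrix.mul_apply, chi_eq_sum_stdAddChar, ← Finset.sum_coe_sort A, Finset.mul_sum]
      refine Finset.sum_congr rfl fun a _ => ?_
      rw [hU, hV, mul_assoc, ← AddChar.map_add_eq_mul]
      congr 2
      ring
    rw [h2, Matrix.one_apply]
    split_ifs with hbb
    · rw [hbb, sub_self, chi_eq_sum_stdAddChar]
      simp [hA]
    · rw [h.2 b' b'.2 b b.2 fun h3 => hbb (Subtype.ext h3.symm), mul_zero]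
  replace h1 : V * U = 1 :=
    (Matrix.mul_eq_one_comm_of_card_eq _ _ _ (by simpa using h.1.symm)).mp h1
  have h3 := congrFun (congrFun h1 ⟨a, ha⟩) ⟨a', ha'⟩
  rw [Matrix.one_apply, if_neg (by simpa using haa), Matrix.mul_apply] at h3
  have h4 : ∑ b : B, V ⟨a, ha⟩ b * U b ⟨a', ha'⟩ = (A.card : ℂ)⁻¹ * chi N B (a - a') := by
    rw [chi_eq_sum_stdAddChar, ← Finset.sum_coe_sort B, Finset.mul_sum]
    refine Finset.sum_congr rfl fun b _ => ?_
    rw [hU, hV, mul_left_comm, ← AddChar.map_add_eq_mul]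
    congr 2
    ring
  rw [h4] at h3
  exact (mul_eq_zero.mp h3).resolve_left (inv_ne_zero hA)

lemma exists_not_modEq_of_closure_eq_top {l : ℕ} (hl : 1 < l) (hlN : l ∣ N)
    {B : Finset (ZMod N)} (h0 : (0 : ZMod N) ∈ B)
    (hgen : AddSubgroup.closure (B : Set (ZMod N)) = ⊤) :
    ¬ ∀ b ∈ B.image ZMod.val, ∀ b' ∈ B.image ZMod.val, b ≡ b' [MOD l] := by
  intro h
  have h1 : AddSubgroup.closure (B : Set (ZMod N))
      ≤ (ZMod.castHom hlN (ZMod l)).toAddMonoidHom.ker := by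
    rw [AddSubgroup.closure_le]
    intro b hb
    have := h _ (mem_image_of_mem _ hb) _ (mem_image_of_mem _ h0)
    rw [val_modEq_iff hlN, map_zero] at this
    exact this
  rw [hgen] at h1
  have h2 : (ZMod.castHom hlN (ZMod l)) 1 = 0 := h1 (AddSubgroup.mem_top 1)
  rw [map_one] at h2
  have : Fact (1 < l) := ⟨hl⟩
  exact one_ne_zero h2

end

lemma natCast_card_filter_eq_sum (A : Finset ℕ) (P : ℕ → Prop) [DecidablePred P] :
    (((A.filter P).card : ℤ) : ℂ) = ∑ a ∈ A, if P a then 1 else 0 := by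
  rw [Finset.card_filter]
  push_cast
  rfl

lemma ite_and_eq_mul (P Q : Prop) [Decidable P] [Decidable Q] :
    (if P ∧ Q then (1 : ℂ) else 0) = (if P then 1 else 0) * if Q then 1 else 0 := by
  by_cases hP : P <;> by_cases hQ : Q <;> simp [hP, hQ]

section

variable {p q r : ℕ} [NeZero q] [NeZero r] {A : Finset ℕ} {i : ℕ}

lemma vanP_of_forall_rootSpan (hp : p.Prime)
    (h : ∀ f ∈ rootSpan (p ^ (i + 1)), ∑ a ∈ A, f a = 0) : VanP p q r A i := by
  intro x x' hx
  have := h _ (sub_indicator_mem_rootSpan hp i hx)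
  simp only [sum_sum_wt]
  rw [Finset.sum_sub_distrib, ← natCast_card_filter_eq_sum, ← natCast_card_filter_eq_sum] at this
  exact_mod_cast sub_eq_zero.mp this

lemma vanPQ_of_forall_rootSpan (hp : p.Prime) (hq : q.Prime) (hpq : p ≠ q)
    (h : ∀ f ∈ rootSpan (p ^ (i + 1) * q), ∑ a ∈ A, f a = 0) : VanPQ p q r A i := by
  intro x x' hx j l
  have := h _ (mul_mem_rootSpan (((Nat.coprime_primes hp hq).mpr hpq).pow_left _)
    (sub_indicator_mem_rootSpan hp i hx) (sub_indicator_cast_mem_rootSpan hq j l))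
  simp only [Pi.mul_apply, sub_mul, mul_sub, Finset.sum_sub_distrib, ← ite_and_eq_mul,
    ← natCast_card_filter_eq_sum] at this
  simp only [sum_wt_right]
  rw [← Int.cast_inj (α := ℂ)]
  push_cast at this ⊢
  linear_combination this

lemma vanPR_of_forall_rootSpan (hp : p.Prime) (hr : r.Prime) (hpr : p ≠ r)
    (h : ∀ f ∈ rootSpan (p ^ (i + 1) * r), ∑ a ∈ A, f a = 0) : VanPR p q r A i := by
  intro x x' hx k k'
  have := h _ (mul_mem_rootSpan (((Nat.coprime_primes hp hr).mpr hpr).pow_left _)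
    (sub_indicator_mem_rootSpan hp i hx) (sub_indicator_cast_mem_rootSpan hr k k'))
  simp only [Pi.mul_apply, sub_mul, mul_sub, Finset.sum_sub_distrib, ← ite_and_eq_mul,
    ← natCast_card_filter_eq_sum] at this
  simp only [sum_wt_left]
  rw [← Int.cast_inj (α := ℂ)]
  push_cast at this ⊢
  linear_combination this

lemma vanPQR_of_forall_rootSpan (hp : p.Prime) (hq : q.Prime) (hr : r.Prime) (hpq : p ≠ q)
    (hpr : p ≠ r) (hqr : q ≠ r)
    (h : ∀ f ∈ rootSpan (p ^ (i + 1) * (q * r)), ∑ a ∈ A, f a = 0) : VanPQR p q r A i := by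
  intro x x' hx j l k k'
  have := h _ (mul_mem_rootSpan (Nat.Coprime.mul_right
      (((Nat.coprime_primes hp hq).mpr hpq).pow_left _)
      (((Nat.coprime_primes hp hr).mpr hpr).pow_left _))
    (sub_indicator_mem_rootSpan hp i hx) (mul_mem_rootSpan ((Nat.coprime_primes hq hr).mpr hqr)
      (sub_indicator_cast_mem_rootSpan hq j l) (sub_indicator_cast_mem_rootSpan hr k k')))
  simp only [Pi.mul_apply, sub_mul, mul_sub, Finset.sum_sub_distrib, ← ite_and_eq_mul,
    ← natCast_card_filter_eq_sum] at this
  simp only [wt]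
  rw [← Int.cast_inj (α := ℂ)]
  push_cast at this ⊢
  linear_combination this

lemma vanR_of_forall_rootSpan (hr : r.Prime)
    (h : ∀ f ∈ rootSpan r, ∑ a ∈ A, f a = 0) : VanR p q r A := by
  intro k k'
  have := h _ (sub_indicator_cast_mem_rootSpan hr k k')
  simp only [sum_wt_left, pow_zero, Nat.modEq_one, true_and]
  rw [Finset.sum_sub_distrib, ← natCast_card_filter_eq_sum, ← natCast_card_filter_eq_sum] at this
  exact_mod_cast sub_eq_zero.mp this

lemma vanQR_of_forall_rootSpan (hq : q.Prime) (hr : r.Prime) (hqr : q ≠ r)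
    (h : ∀ f ∈ rootSpan (q * r), ∑ a ∈ A, f a = 0) : VanQR p q r A := by
  intro j l k k'
  have := h _ (mul_mem_rootSpan ((Nat.coprime_primes hq hr).mpr hqr)
      (sub_indicator_cast_mem_rootSpan hq j l) (sub_indicator_cast_mem_rootSpan hr k k'))
  simp only [Pi.mul_apply, sub_mul, mul_sub, Finset.sum_sub_distrib, ← ite_and_eq_mul,
    ← natCast_card_filter_eq_sum] at this
  simp only [wt, pow_zero, Nat.modEq_one, true_and]
  rw [← Int.cast_inj (α := ℂ)]
  push_cast at this ⊢
  linear_combination this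

end

lemma gcd_eq_right_or_one {q v : ℕ} (hq : q.Prime) : q.gcd v = if q ∣ v then q else 1 := by
  split_ifs with h
  · exact Nat.gcd_eq_left h
  · exact (Nat.Prime.coprime_iff_not_dvd hq).mpr h

lemma gcd_prime_pow_eq {p n e v : ℕ} (hp : p.Prime) (he : e ≤ n) (h : p ^ e ∣ v)
    (h' : ¬ p ^ (e + 1) ∣ v) : (p ^ n).gcd v = p ^ e := by
  obtain ⟨k, hk, hk'⟩ := (Nat.dvd_prime_pow hp).mp (Nat.gcd_dvd_left (p ^ n) v)
  have h1 : p ^ e ∣ p ^ k := hk' ▸ Nat.dvd_gcd (pow_dvd_pow p he) h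
  have h2 := (Nat.pow_dvd_pow_iff_le_right hp.one_lt).mp h1
  have h3 : ¬ e + 1 ≤ k := fun h3 =>
    h' (((pow_dvd_pow p h3).trans (dvd_of_eq hk'.symm)).trans (Nat.gcd_dvd_right _ _))
  rw [hk', show k = e by omega]

lemma dvd_val_sub_iff {N l : ℕ} [NeZero N] (hl : l ∣ N) (b b' : ZMod N) :
    l ∣ (b - b').val ↔ b.val ≡ b'.val [MOD l] := by
  rw [val_modEq_iff hl, ← sub_eq_zero, ← map_sub, ← Nat.modEq_zero_iff_dvd]
  have := val_modEq_iff hl (b - b') 0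
  rwa [ZMod.val_zero, map_zero] at this

lemma gcd_mul_mul_eq {p q r n : ℕ} (hp : p.Prime) (hq : q.Prime) (hr : r.Prime) (hpq : p ≠ q)
    (hpr : p ≠ r) (hqr : q ≠ r) (v : ℕ) :
    (p ^ n * q * r).gcd v = (p ^ n).gcd v * q.gcd v * r.gcd v := by
  have h1 : (p ^ n).Coprime q := ((Nat.coprime_primes hp hq).mpr hpq).pow_left _
  have h2 : (p ^ n).Coprime r := ((Nat.coprime_primes hp hr).mpr hpr).pow_left _
  have h3 : q.Coprime r := (Nat.coprime_primes hq hr).mpr hqr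
  rw [Nat.gcd_comm, Nat.Coprime.gcd_mul _ (Nat.Coprime.mul_left h2 h3), Nat.Coprime.gcd_mul _ h1]
  simp only [Nat.gcd_comm]

lemma val_eq_of_modEq {p q r n N : ℕ} [NeZero N] (hp : p.Prime) (hq : q.Prime) (hr : r.Prime)
    (hpq : p ≠ q) (hpr : p ≠ r) (hqr : q ≠ r) (hN : N = p ^ n * q * r) {b b' : ZMod N}
    (h1 : b.val ≡ b'.val [MOD p ^ n]) (h2 : b.val ≡ b'.val [MOD q])
    (h3 : b.val ≡ b'.val [MOD r]) : b = b' := by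
  have h4 : (p ^ n).Coprime q := ((Nat.coprime_primes hp hq).mpr hpq).pow_left _
  have h5 : (p ^ n).Coprime r := ((Nat.coprime_primes hp hr).mpr hpr).pow_left _
  have h6 : q.Coprime r := (Nat.coprime_primes hq hr).mpr hqr
  have h7 := (Nat.modEq_and_modEq_iff_modEq_mul (Nat.Coprime.mul_left h5 h6)).mp
    ⟨(Nat.modEq_and_modEq_iff_modEq_mul h4).mp ⟨h1, h2⟩, h3⟩
  rw [← hN] at h7
  exact ZMod.val_injective N (Nat.ModEq.eq_of_lt_of_lt h7 (ZMod.val_lt _) (ZMod.val_lt _))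

lemma diffVanish_of_isSpectralPair {p q r n N : ℕ} [NeZero q] [NeZero r] [NeZero N] (hp : p.Prime)
    (hq : q.Prime) (hr : r.Prime) (hpq : p ≠ q) (hpr : p ≠ r) (hqr : q ≠ r)
    (hN : N = p ^ n * q * r) {A B : Finset (ZMod N)} (h : IsSpectralPair N A B)
    (hA : chi N A ((p ^ n * r : ℕ) : ZMod N) ≠ 0) :
    DiffVanish p q r n (A.image ZMod.val) (B.image ZMod.val) := by
  have hdp : ∀ i, i ≤ n → p ^ i ∣ N := fun i hi => by
    rw [hN, mul_assoc]; exact (pow_dvd_pow p hi).mul_right _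
  have hdq : q ∣ N := ⟨p ^ n * r, by rw [hN]; ring⟩
  have hdr : r ∣ N := ⟨p ^ n * q, by rw [hN]; ring⟩
  have hgcd : ∀ v, N.gcd v = (p ^ n).gcd v * (if q ∣ v then q else 1) * if r ∣ v then r else 1 :=
    fun v => by
      rw [hN, gcd_mul_mul_eq hp hq hr hpq hpr hqr, gcd_eq_right_or_one hq, gcd_eq_right_or_one hr]
  have hlow : ∀ b ∈ B, ∀ b' ∈ B, ∀ e i, e + i + 1 = n → b.val ≡ b'.val [MOD p ^ e] →
      ¬ b.val ≡ b'.val [MOD p ^ (e + 1)] → ∀ f ∈ rootSpan (p ^ (i + 1) *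
        ((if b.val ≡ b'.val [MOD q] then 1 else q) * if b.val ≡ b'.val [MOD r] then 1 else r)),
      ∑ a ∈ A.image ZMod.val, f a = 0 := by
    intro b hb b' hb' e i hei h1 h2 f hf
    refine sum_eq_zero_of_chi_eq_zero (h.2 b hb b' hb' ?_) ?_ hf
    · rintro rfl; exact h2 rfl
    · rw [← dvd_val_sub_iff (hdp _ (by omega))] at h1 h2
      rw [hgcd, gcd_prime_pow_eq hp (by omega) h1 h2]
      simp only [dvd_val_sub_iff hdq, dvd_val_sub_iff hdr]
      conv_rhs => rw [hN, ← hei]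
      split_ifs <;> ring
  have htop : ∀ b ∈ B, ∀ b' ∈ B, b.val ≡ b'.val [MOD p ^ n] → b ≠ b' → ∀ f ∈ rootSpan
        ((if b.val ≡ b'.val [MOD q] then 1 else q) * if b.val ≡ b'.val [MOD r] then 1 else r),
      ∑ a ∈ A.image ZMod.val, f a = 0 := by
    intro b hb b' hb' h1 h2 f hf
    refine sum_eq_zero_of_chi_eq_zero (h.2 b hb b' hb' h2) ?_ hf
    rw [← dvd_val_sub_iff (hdp _ le_rfl)] at h1
    rw [hgcd, Nat.gcd_eq_left h1]
    simp only [dvd_val_sub_iff hdq, dvd_val_sub_iff hdr]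
    conv_rhs => rw [hN]
    split_ifs <;> ring
  constructor
  all_goals simp only [Finset.forall_mem_image, ZMod.natCast_eq_natCast_iff, ne_eq]
  · intro b hb b' hb' e i hei h1 h2 hq' hr'
    have := hlow b hb b' hb' e i hei h1 h2
    simp only [hq', hr', if_true, mul_one] at this
    exact vanP_of_forall_rootSpan hp this
  · intro b hb b' hb' e i hei h1 h2 hq' hr'
    have := hlow b hb b' hb' e i hei h1 h2
    simp only [hq', hr', if_true, if_false, mul_one] at this
    exact vanPQ_of_forall_rootSpan hp hq hpq this
  · intro b hb b' hb' e i hei h1 h2 hq' hr'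
    have := hlow b hb b' hb' e i hei h1 h2
    simp only [hq', hr', if_true, if_false, one_mul] at this
    exact vanPR_of_forall_rootSpan hp hr hpr this
  · intro b hb b' hb' e i hei h1 h2 hq' hr'
    have := hlow b hb b' hb' e i hei h1 h2
    simp only [hq', hr', if_false] at this
    exact vanPQR_of_forall_rootSpan hp hq hr hpq hpr hqr this
  · intro b hb b' hb' h1 hq' hr'
    have := htop b hb b' hb' h1 (by rintro rfl; exact hr' rfl)
    simp only [hq', hr', if_true, if_false, one_mul] at this
    exact vanR_of_forall_rootSpan hr this
  · intro b hb b' hb' h1 hq' hr'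
    have := htop b hb b' hb' h1 (by rintro rfl; exact hr' rfl)
    simp only [hq', hr', if_false] at this
    exact vanQR_of_forall_rootSpan hq hr hqr this
  · intro b hb b' hb' h1 hr'
    congr 1
    by_contra hne
    refine hA (chi_eq_zero_of_gcd_eq (h.2 b hb b' hb' hne) ?_)
    have hq' : ¬ b.val ≡ b'.val [MOD q] := fun hq' =>
      hne (val_eq_of_modEq hp hq hr hpq hpr hqr hN h1 hq' hr')
    have hlt : p ^ n * r < N := by
      rw [hN, mul_right_comm]
      exact lt_mul_of_one_lt_right (Nat.mul_pos (pow_pos hp.pos n) hr.pos) hq.one_lt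
    rw [ZMod.val_cast_of_lt hlt]
    rw [← dvd_val_sub_iff (hdp _ le_rfl)] at h1
    rw [hgcd, Nat.gcd_eq_left h1]
    simp only [dvd_val_sub_iff hdq, dvd_val_sub_iff hdr, hq', hr', if_true, if_false, mul_one]
    exact (Nat.gcd_eq_right ⟨q, by rw [hN]; ring⟩).symm

lemma chi_eq_zero_or_chi_eq_zero {p q r n N : ℕ} (hp : p.Prime) (hq : q.Prime) (hr : r.Prime)
    (hpq : p ≠ q) (hpr : p ≠ r) (hqr : q ≠ r) (hn : 0 < n) (hN : N = p ^ n * q * r)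
    {A B : Finset (ZMod N)} (hAB : IsSpectralPair N A B) (h0B : (0 : ZMod N) ∈ B)
    (hgenB : AddSubgroup.closure (B : Set (ZMod N)) = ⊤)
    (hcosP : ¬ IsUnionOfCosets N p A) (hcosR : ¬ IsUnionOfCosets N r A)
    (hnotile : ¬ Tiles N A) :
    chi N A ((p ^ n * r : ℕ) : ZMod N) = 0 ∨ chi N B ((p ^ n * r : ℕ) : ZMod N) = 0 := by
  by_contra! hne
  obtain ⟨hA, hB⟩ := hne
  have : NeZero q := ⟨hq.ne_zero⟩
  have : NeZero r := ⟨hr.ne_zero⟩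
  have hN0 : NeZero N := ⟨by
    rw [hN]; exact (Nat.mul_pos (Nat.mul_pos (pow_pos hp.pos n) hq.pos) hr.pos).ne'⟩
  have hdp : ∀ i, i ≤ n → p ^ i ∣ N := fun i hi => by
    rw [hN, mul_assoc]; exact (pow_dvd_pow p hi).mul_right _
  have hdq : q ∣ N := ⟨p ^ n * r, by rw [hN]; ring⟩
  have hdr : r ∣ N := ⟨p ^ n * q, by rw [hN]; ring⟩
  have hdiv : ∀ l m, 0 < l → N = l * m → ∀ x : ZMod N, (l : ZMod N) * x = 0 → ∀ d, d ∣ N → d ∣ m →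
      ∀ a, (a + x).val ≡ a.val [MOD d] := by
    intro l m hl hlm x hx d hdN hd a
    rw [← dvd_val_sub_iff hdN, add_sub_cancel_left]
    refine hd.trans (Nat.dvd_of_mul_dvd_mul_left hl ?_)
    rw [← hlm, ← ZMod.natCast_eq_zero_iff, Nat.cast_mul, ZMod.natCast_zmod_val, hx]
  have H : CubePair p q r n (A.image ZMod.val) (B.image ZMod.val) :=
    { hp := hp, hq := hq, hr := hr, hpq := hpq, hpr := hpr, hqr := hqr, hn := hn
      hAB := diffVanish_of_isSpectralPair hp hq hr hpq hpr hqr hN hAB hA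
      hBA := diffVanish_of_isSpectralPair hp hq hr hpq hpr hqr hN hAB.symm hB
      card_eq := by
        rw [card_image_of_injective _ (ZMod.val_injective N),
          card_image_of_injective _ (ZMod.val_injective N), hAB.1]
      nonempty := ⟨_, mem_image_of_mem _ h0B⟩
      digit := exists_not_modEq_of_closure_eq_top hp.one_lt
        (by simpa using hdp 1 hn) h0B hgenB
      resQ := by
        simp only [ZMod.natCast_eq_natCast_iff]
        exact exists_not_modEq_of_closure_eq_top hq.one_lt hdq h0B hgenB
      resR := by
        simp only [ZMod.natCast_eq_natCast_iff]
        exact exists_not_modEq_of_closure_eq_top hr.one_lt hdr h0B hgenB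
      notP := by
        rw [IsUnionOfCosets] at hcosP
        push Not at hcosP
        obtain ⟨a, ha, x, hx, hax⟩ := hcosP
        have key := hdiv p (p ^ (n - 1) * q * r) hp.pos (by
          rw [hN, ← mul_assoc, ← mul_assoc, ← pow_succ', Nat.sub_add_cancel hn]) x hx
        refine ⟨a.val, mem_image_of_mem _ ha, (a + x).val, key _ (hdp _ (Nat.sub_le _ _))
          (by rw [mul_assoc]; exact dvd_mul_right _ _) a, ?_⟩
        by_contra hw
        obtain ⟨c, hc, h1, h2, h3⟩ := wt_ne_zero_iff.mp hw
        obtain ⟨c, hc', rfl⟩ := mem_image.mp hc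
        rw [ZMod.natCast_eq_natCast_iff] at h2 h3
        refine hax (Eq.subst (motive := (· ∈ A)) ?_ hc')
        exact val_eq_of_modEq hp hq hr hpq hpr hqr hN h1
          (h2.trans (key q hdq ⟨p ^ (n - 1) * r, by ring⟩ a).symm)
          (h3.trans (key r hdr (dvd_mul_left _ _) a).symm)
      notR := by
        rw [IsUnionOfCosets] at hcosR
        push Not at hcosR
        obtain ⟨a, ha, x, hx, hax⟩ := hcosR
        have key := hdiv r (p ^ n * q) hr.pos (by rw [hN]; ring) x hx
        refine ⟨a.val, mem_image_of_mem _ ha, ((a + x).val : ZMod r), ?_⟩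
        by_contra hw
        obtain ⟨c, hc, h1, h2, h3⟩ := wt_ne_zero_iff.mp hw
        obtain ⟨c, hc', rfl⟩ := mem_image.mp hc
        rw [ZMod.natCast_eq_natCast_iff] at h2 h3
        refine hax (Eq.subst (motive := (· ∈ A)) ?_ hc')
        exact val_eq_of_modEq hp hq hr hpq hpr hqr hN
          (h1.trans (key _ (hdp n le_rfl) (dvd_mul_right _ _) a).symm)
          (h2.trans (key q hdq (dvd_mul_left _ _) a).symm) h3 }
  refine hnotile (tiles_of_slices hp.pos hN A (pLevels p q r n (A.image ZMod.val))
    (fun i hi => (mem_pLevels.mp hi).1) (fun k => ?_) fun i hi x x' hx k => ?_)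
  · have := H.card_slice_left k
    rw [sum_wt_left] at this
    simp only [pow_zero, Nat.modEq_one, true_and] at this
    exact_mod_cast this
  · have := H.sliceVan hi x x' hx k
    rw [sum_wt_left, sum_wt_left] at this
    exact_mod_cast this

lemma two_le_ncard_inter_add_ncard_inter {α : Type*} {S T : Set α} {u v : α} (huv : u ≠ v)
    (hu : u ∈ S ∨ u ∈ T) (hv : v ∈ S ∨ v ∈ T) :
    2 ≤ (S ∩ {u, v}).ncard + (T ∩ {u, v}).ncard := by
  have h : ({u, v} : Set α) ⊆ S ∩ {u, v} ∪ T ∩ {u, v} := by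
    rw [← Set.union_inter_distrib_right]
    rintro w (rfl | rfl)
    · exact ⟨hu, by simp⟩
    · exact ⟨hv, by simp⟩
  calc 2 = ({u, v} : Set α).ncard := (Set.ncard_pair huv).symm
    _ ≤ (S ∩ {u, v} ∪ T ∩ {u, v}).ncard := Set.ncard_le_ncard h
        (((Set.toFinite {u, v}).inter_of_right S).union ((Set.toFinite {u, v}).inter_of_right T))
    _ ≤ _ := Set.ncard_union_le _ _

theorem I2_card_add_J2_card_ge_two (p q r n : ℕ) (hp : p.Prime) (hq : q.Prime) (hr : r.Prime)
    (hpq : p ≠ q) (hpr : p ≠ r) (hqr : q ≠ r) (hn : 0 < n)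
    (N : ℕ) (hN : N = p ^ n * q * r)
    (A B : Finset (ZMod N)) (hAB : IsSpectralPair N A B)
    (hA1 : 1 < A.card) (hA2 : A.card < N)
    (h0A : (0 : ZMod N) ∈ A) (h0B : (0 : ZMod N) ∈ B)
    (hgenA : AddSubgroup.closure (A : Set (ZMod N)) = ⊤)
    (hgenB : AddSubgroup.closure (B : Set (ZMod N)) = ⊤)
    (hcosP : ¬ IsUnionOfCosets N p A) (hcosQ : ¬ IsUnionOfCosets N q A)
    (hcosR : ¬ IsUnionOfCosets N r A)
    (hnotile : ¬ Tiles N A) :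
    (chi N A ((p ^ n * r : ℕ) : ZMod N) = 0 ∨ chi N B ((p ^ n * r : ℕ) : ZMod N) = 0) ∧
    (chi N A ((p ^ n * q : ℕ) : ZMod N) = 0 ∨ chi N B ((p ^ n * q : ℕ) : ZMod N) = 0) ∧
    2 ≤ ({b : ZMod N | chi N A b = 0} ∩
          {((p ^ n * q : ℕ) : ZMod N), ((p ^ n * r : ℕ) : ZMod N)}).ncard +
        ({b : ZMod N | chi N B b = 0} ∩
          {((p ^ n * q : ℕ) : ZMod N), ((p ^ n * r : ℕ) : ZMod N)}).ncard := by
  have h1 := chi_eq_zero_or_chi_eq_zero hp hq hr hpq hpr hqr hn hN hAB h0B hgenB hcosP hcosR hnotile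
  have h2 := chi_eq_zero_or_chi_eq_zero hp hr hq hpr hpq hqr.symm hn (by rw [hN]; ring) hAB h0B
    hgenB hcosP hcosQ hnotile
  refine ⟨h1, h2, two_le_ncard_inter_add_ncard_inter (fun h => ?_) h2 h1⟩
  have hpn : 0 < p ^ n := pow_pos hp.pos n
  have hlt : p ^ n * q < N := by
    rw [hN]
    exact lt_mul_of_one_lt_right (Nat.mul_pos hpn hq.pos) hr.one_lt
  have hlt' : p ^ n * r < N := by
    rw [hN, mul_right_comm]
    exact lt_mul_of_one_lt_right (Nat.mul_pos hpn hr.pos) hq.one_lt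
  rw [ZMod.natCast_eq_natCast_iff] at h
  exact hqr (Nat.eq_of_mul_eq_mul_left hpn (Nat.ModEq.eq_of_lt_of_lt h hlt hlt'))
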